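/- arXiv:1911.02164 — 2 statements merged into one kernel-verified Lean document; each statement's English description precedes it below -/
import Mathlib

section
/- (Sturm Comparison Theorem I) Assume α is strictly increasing on (a,b), β₁, β₂ ∈ BV_loc((a,b),ℝ), and ω₁(x) ≠ 0 and ω₂(x) ≠ 0 for all x ∈ (a,b). Let u and v be nontrivial real-valued balanced solutions of −d(dy/dα) + y dβ₁ = 0 and −d(dy/dα) + y dβ₂ = 0 on (a,b), respectively, and let s < t be consecutive points of Z_{(a,b)}(u). Then: (1) if u^+(s) = u^-(t) = 0 and d(β₁−β₂) is a nontrivial positive measure on (s,t), then v changes sign in (s,t); (2) if u^-(s) = u^-(t) = 0, ω₁(s) > 0, and d(β₁−β₂) is a positive measure on [s,t), then v changes sign in [s,t); (3) if u^+(s) = u^+(t) = 0, ω₁(t) > 0, and d(β₁−β₂) is a positive measure on (s,t], then v changes sign in (s,t]; (4) if u^-(s) = u^+(t) = 0, ω₁(s) > 0, ω₁(t) > 0, and d(β₁−β₂) is a positive measure on [s,t], then v changes sign in [s,t]. -/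
open Set Filter Function MeasureTheory Topology

noncomputable section

/-- The open interval `(a,b) ⊆ ℝ` determined by extended-real endpoints `a`, `b`. -/
def EI (a b : EReal) : Set ℝ := {x : ℝ | a < (x : EReal) ∧ (x : EReal) < b}

/-- The jump `Δ_{df}(x) = f⁺(x) - f⁻(x)` of a real-valued function. -/
def jump (f : ℝ → ℝ) (x : ℝ) : ℝ := rightLim f x - leftLim f x

/-- The jump `Δ_{df}(x) = f⁺(x) - f⁻(x)` of a complex-valued function. -/
def jumpC (f : ℝ → ℂ) (x : ℝ) : ℂ := rightLim f x - leftLim f x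

/-- `θ_z(x) = 1 - z² Δ_{dα}(x) Δ_{dβ}(x)`. -/
def theta (α β : ℝ → ℝ) (z x : ℝ) : ℝ := 1 - z ^ 2 * jump α x * jump β x

/-- `ω(x) = 1 - Δ_{dα}(x) Δ_{dβ}(x) / 4`. -/
def omegaFn (α β : ℝ → ℝ) (x : ℝ) : ℝ := 1 - jump α x * jump β x / 4

/-- A real-valued function is `r`-balanced on `I`: it is of locally bounded variation and
`f(x) = r f⁻(x) + (1-r) f⁺(x)` for all `x ∈ I`. -/
def RBalanced (r : ℝ) (I : Set ℝ) (f : ℝ → ℝ) : Prop :=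
  LocallyBoundedVariationOn f I ∧
    ∀ x ∈ I, f x = r * leftLim f x + (1 - r) * rightLim f x

/-- A complex-valued function is `r`-balanced on `I`. -/
def RBalancedC (r : ℂ) (I : Set ℝ) (f : ℝ → ℂ) : Prop :=
  LocallyBoundedVariationOn f I ∧
    ∀ x ∈ I, f x = r * leftLim f x + (1 - r) * rightLim f x

/-- `ν` coincides on `[c,d]` with the Lebesgue–Stieltjes measure `df` generated by `f`,
determined by `df((x,y]) = f⁺(y) - f⁺(x)`. -/
def SMRepresents (ν : SignedMeasure ℝ) (f : ℝ → ℝ) (c d : ℝ) : Prop :=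
  ∀ x ∈ Icc c d, ∀ y ∈ Icc c d, x ≤ y → ν (Ioc x y) = rightLim f y - rightLim f x

/-- The integral of `h` against the signed measure `ν` over the set `E`. -/
def sInt (ν : SignedMeasure ℝ) (h : ℝ → ℝ) (E : Set ℝ) : ℝ :=
  (∫ x in E, h x ∂ν.toJordanDecomposition.posPart) -
    (∫ x in E, h x ∂ν.toJordanDecomposition.negPart)

/-- The equality of (locally finite, real Borel) measures `dg = ∑ j, (h j) d(β j)` on the
interval `I`, expressed via localizations to compact subintervals of `I`. -/
def MeasureEqOn (I : Set ℝ) {ι : Type} [Fintype ι] (g : ℝ → ℝ) (h β : ι → ℝ → ℝ) : Prop :=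
  ∀ c ∈ I, ∀ d ∈ I, c < d →
    ∃ (νg : SignedMeasure ℝ) (ν : ι → SignedMeasure ℝ),
      SMRepresents νg g c d ∧ (∀ j, SMRepresents (ν j) (β j) c d) ∧
      ∀ E : Set ℝ, E ⊆ Ioc c d → MeasurableSet E → νg E = ∑ j, sInt (ν j) (h j) E

/-- The equality of complex measures `dg = ∑ j, (h j) d(β j)` on `I`, encoded via real and
imaginary parts. -/
def MeasureEqOnC (I : Set ℝ) {ι : Type} [Fintype ι] (g : ℝ → ℂ) (h β : ι → ℝ → ℂ) : Prop :=
  MeasureEqOn I (fun x => (g x).re)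
    (Sum.elim (fun j x => (h j x).re) (fun j x => -(h j x).im))
    (Sum.elim (fun j x => (β j x).re) (fun j x => (β j x).im)) ∧
  MeasureEqOn I (fun x => (g x).im)
    (Sum.elim (fun j x => (h j x).im) (fun j x => (h j x).re))
    (Sum.elim (fun j x => (β j x).re) (fun j x => (β j x).im))

/-- The support of `dα` is all of `I`: no open subinterval of `I` is `dα`-null, i.e. on no
open subinterval of `I` do all one-sided limits of `α` coincide with a single constant. -/
def SuppFull (I : Set ℝ) (α : ℝ → ℂ) : Prop :=
  ∀ x ∈ I, ∀ ε > (0 : ℝ), Icc (x - ε) (x + ε) ⊆ I →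
    ¬ (∀ p ∈ Ioo (x - ε) (x + ε), ∀ q ∈ Ioo (x - ε) (x + ε),
        rightLim α p = rightLim α q ∧ leftLim α p = rightLim α q)

/-- `u`, together with the representative `w` of `du/dα`, is an `r`-balanced solution of the
homogeneous equation `-d(du/dα) + u dβ = 0` on `I`: `u` and `w` are `r`-balanced,
`du = w dα` (so `du ≪ dα` with `du/dα = w`), and `dw = u dβ`. -/
def IsHomSol (I : Set ℝ) (r : ℝ) (α β u w : ℝ → ℝ) : Prop :=
  RBalanced r I u ∧ RBalanced r I w ∧
  MeasureEqOn I u (fun _ : Fin 1 => w) (fun _ => α) ∧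
  MeasureEqOn I w (fun _ : Fin 1 => u) (fun _ => β)

/-- `u`, together with the representative `w` of `du/dα`, is an `r`-balanced solution of
`-d(du/dα) + u dβ = dη` on `I` (complex-valued coefficients): `dw = u dβ - dη`. -/
def IsSolC (I : Set ℝ) (r : ℂ) (α β η u w : ℝ → ℂ) : Prop :=
  RBalancedC r I u ∧ RBalancedC r I w ∧
  MeasureEqOnC I u (fun _ : Fin 1 => w) (fun _ => α) ∧
  MeasureEqOnC I w ![u, fun _ => (-1 : ℂ)] ![β, η]

/-- `y` solves the linear system `dy = dφ · y + dψ` on `I`, componentwise: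
`d(y i) = ∑ j, (y j) d(φ i j) + dψ i`. -/
def IsSysSolC (I : Set ℝ) (n : ℕ) (φ : ℝ → Matrix (Fin n) (Fin n) ℂ)
    (ψ : ℝ → Fin n → ℂ) (y : ℝ → Fin n → ℂ) : Prop :=
  ∀ i : Fin n,
    MeasureEqOnC I (fun x => y x i)
      (Sum.elim (fun j : Fin n => fun x => y x j) (fun _ : Unit => fun _ => (1 : ℂ)))
      (Sum.elim (fun j : Fin n => fun x => φ x i j) (fun _ : Unit => fun x => ψ x i))

/-- `Z_I(f) = {x ∈ I : f⁻(x) f⁺(x) ≤ 0}`, the set of sign-changing points of `f` in `I`. -/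
def ZSet (f : ℝ → ℝ) (I : Set ℝ) : Set ℝ := {x ∈ I | leftLim f x * rightLim f x ≤ 0}

/-- `u` changes sign at `s ∈ I`. -/
def ChangesSignAt (I : Set ℝ) (u : ℝ → ℝ) (s : ℝ) : Prop :=
  ∃ δ > (0 : ℝ), Ioo (s - δ) (s + δ) ⊆ I ∧
    (((∀ x ∈ Ioo (s - δ) s, leftLim u x < 0) ∧ ∀ x ∈ Ioo s (s + δ), 0 < rightLim u x) ∨
     ((∀ x ∈ Ioo (s - δ) s, 0 < leftLim u x) ∧ ∀ x ∈ Ioo s (s + δ), rightLim u x < 0))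

/-- `u` changes sign in `J` (a subinterval of `I`). -/
def ChangesSignIn (I : Set ℝ) (u : ℝ → ℝ) (J : Set ℝ) : Prop :=
  ∃ s ∈ J, ChangesSignAt I u s

/-- `u` and `v` are linearly dependent on `I`. -/
def LinDepOn (I : Set ℝ) (u v : ℝ → ℝ) : Prop :=
  ∃ c₁ c₂ : ℝ, ¬(c₁ = 0 ∧ c₂ = 0) ∧ ∀ x ∈ I, c₁ * u x + c₂ * v x = 0

/-- The Lebesgue–Stieltjes measure `dg` is nonnegative on (Borel subsets of) `S`, expressed by
nonnegativity on all subintervals of `S` of each of the four kinds. -/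
def PosMeasureOn (g : ℝ → ℝ) (S : Set ℝ) : Prop :=
  (∀ x y : ℝ, x ≤ y → Icc x y ⊆ S → 0 ≤ rightLim g y - leftLim g x) ∧
  (∀ x y : ℝ, x ≤ y → Ico x y ⊆ S → 0 ≤ leftLim g y - leftLim g x) ∧
  (∀ x y : ℝ, x ≤ y → Ioc x y ⊆ S → 0 ≤ rightLim g y - rightLim g x) ∧
  (∀ x y : ℝ, x < y → Ioo x y ⊆ S → 0 ≤ leftLim g y - rightLim g x)

/-- A pair of functions recording the right-hand and left-hand limits of a function. -/
structure SidedFun where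
  /-- the right-hand limits -/
  r : ℝ → ℝ
  /-- the left-hand limits -/
  l : ℝ → ℝ

namespace SidedFun

/-- The balanced value. -/
def avg (F : SidedFun) (x : ℝ) : ℝ := (F.r x + F.l x) / 2

/-- Pointwise negation. -/
def neg (F : SidedFun) : SidedFun := ⟨fun x => -F.r x, fun x => -F.l x⟩

/-- The reflection `x ↦ F (-x)`. -/
def refl (F : SidedFun) : SidedFun := ⟨fun x => F.l (-x), fun x => F.r (-x)⟩

/-- Both components tend to the appropriate one-sided limits at every point of `I`. -/
structure Reg (I : Set ℝ) (F : SidedFun) : Prop where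
  rr : ∀ x ∈ I, Tendsto F.r (𝓝[>] x) (𝓝 (F.r x))
  lr : ∀ x ∈ I, Tendsto F.l (𝓝[>] x) (𝓝 (F.r x))
  rl : ∀ x ∈ I, Tendsto F.r (𝓝[<] x) (𝓝 (F.l x))
  ll : ∀ x ∈ I, Tendsto F.l (𝓝[<] x) (𝓝 (F.l x))

theorem Reg.avg_right {I : Set ℝ} {F : SidedFun} (hF : Reg I F) {x : ℝ} (hx : x ∈ I) :
    Tendsto F.avg (𝓝[>] x) (𝓝 (F.r x)) := by
  have := ((hF.rr x hx).add (hF.lr x hx)).div_const 2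
  rwa [add_self_div_two] at this

theorem Reg.avg_left {I : Set ℝ} {F : SidedFun} (hF : Reg I F) {x : ℝ} (hx : x ∈ I) :
    Tendsto F.avg (𝓝[<] x) (𝓝 (F.l x)) := by
  have := ((hF.rl x hx).add (hF.ll x hx)).div_const 2
  rwa [add_self_div_two] at this

theorem Reg.neg {I : Set ℝ} {F : SidedFun} (hF : Reg I F) : Reg I F.neg :=
  ⟨fun x hx => (hF.rr x hx).neg, fun x hx => (hF.lr x hx).neg,
    fun x hx => (hF.rl x hx).neg, fun x hx => (hF.ll x hx).neg⟩

theorem Reg.refl {I : Set ℝ} {F : SidedFun} (hF : Reg I F) :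
    Reg (Neg.neg ⁻¹' I) F.refl :=
  ⟨fun x hx => (hF.ll (-x) hx).comp tendsto_neg_nhdsGT,
    fun x hx => (hF.rl (-x) hx).comp tendsto_neg_nhdsGT,
    fun x hx => (hF.lr (-x) hx).comp tendsto_neg_nhdsLT,
    fun x hx => (hF.rr (-x) hx).comp tendsto_neg_nhdsLT⟩

/-- A monotonicity criterion: if the increments of `F` are locally bounded below up to an error
that is negligible with respect to a monotone function, then `F` increases. -/
theorem le_of_local_increase {F : SidedFun} {M : ℝ → ℝ} (hM : Monotone M) {c d : ℝ}
    (hcd : c < d)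
    (hR : ∀ x ∈ Ico c d, ∃ R : ℝ → ℝ, R =o[𝓝[>] x] (fun y => M y - M x) ∧
      ∀ᶠ y in 𝓝[>] x, F.r x + R y ≤ F.l y)
    (hL : ∀ x ∈ Ioc c d, ∃ R : ℝ → ℝ, R =o[𝓝[<] x] (fun y => M y - M x) ∧
      ∀ᶠ y in 𝓝[<] x, F.r y ≤ F.l x + R y)
    (hJ : ∀ x ∈ Ioo c d, F.l x ≤ F.r x) : F.r c ≤ F.l d := by
  have hR' : ∀ x ∈ Ico c d, ∀ ε > 0, ∀ᶠ y in 𝓝[>] x, F.r x ≤ F.l y + ε * (M y - M x) := by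
    intro x hx ε hε
    obtain ⟨R, hR1, hR2⟩ := hR x hx
    filter_upwards [hR1.def hε, hR2, self_mem_nhdsWithin] with y h1 h2 h3
    have : 0 ≤ M y - M x := sub_nonneg.2 (hM (le_of_lt h3))
    rw [Real.norm_eq_abs, Real.norm_eq_abs, abs_of_nonneg this] at h1
    linarith [(abs_le.1 h1).1]
  have hL' : ∀ x ∈ Ioc c d, ∀ ε > 0, ∀ᶠ y in 𝓝[<] x, F.r y ≤ F.l x + ε * (M x - M y) := by
    intro x hx ε hε
    obtain ⟨R, hR1, hR2⟩ := hL x hx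
    filter_upwards [hR1.def hε, hR2, self_mem_nhdsWithin] with y h1 h2 h3
    have : M y - M x ≤ 0 := sub_nonpos.2 (hM (le_of_lt h3))
    rw [Real.norm_eq_abs, Real.norm_eq_abs, abs_of_nonpos this] at h1
    linarith [(abs_le.1 h1).2]
  have key : ∀ ε > 0, F.r c ≤ F.l d + ε * (M d - M c) := by
    intro ε hε
    set S : Set ℝ := {y | c < y ∧ y ≤ d ∧ F.r c ≤ F.l y + ε * (M y - M c)} with hS
    have hne : S.Nonempty := by
      obtain ⟨y, h1, h2⟩ :=
        ((hR' c ⟨le_rfl, hcd⟩ ε hε).and (Ioo_mem_nhdsGT hcd)).exists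
      exact ⟨y, h2.1, h2.2.le, h1⟩
    have hbdd : BddAbove S := ⟨d, fun y hy => hy.2.1⟩
    have hlub := isLUB_csSup hne hbdd
    set σ := sSup S
    obtain ⟨y₀, hy₀⟩ := hne
    have hcσ : c < σ := hy₀.1.trans_le (hlub.1 hy₀)
    have hσd : σ ≤ d := hlub.2 fun y hy => hy.2.1
    have hσ : F.r c ≤ F.l σ + ε * (M σ - M c) := by
      obtain ⟨z, hz, hz'⟩ := mem_nhdsLT_iff_exists_Ioo_subset.1 (hL' σ ⟨hcσ, hσd⟩ ε hε)
      obtain ⟨y, hy, hzy, hyσ⟩ := hlub.exists_between hz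
      rcases hyσ.eq_or_lt with rfl | hlt
      · exact hy.2.2
      · have h1 : F.r y ≤ F.l σ + ε * (M σ - M y) := hz' ⟨hzy, hlt⟩
        linarith [hy.2.2, hJ y ⟨hy.1, hlt.trans_le hσd⟩]
    rcases hσd.eq_or_lt with h | h
    · rwa [h] at hσ
    · obtain ⟨y, h1, h2⟩ :=
        ((hR' σ ⟨hcσ.le, h⟩ ε hε).and (Ioo_mem_nhdsGT h)).exists
      have : y ∈ S := ⟨hcσ.trans h2.1, h2.2.le, by linarith [hJ σ ⟨hcσ, h⟩]⟩
      exact absurd (hlub.1 this) (not_le.2 h2.1)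
  have hK : 0 ≤ M d - M c := sub_nonneg.2 (hM hcd.le)
  refine le_of_forall_pos_le_add fun δ hδ => (key (δ / (M d - M c + 1)) (by positivity)).trans ?_
  have : δ / (M d - M c + 1) * (M d - M c) ≤ δ := by
    rw [div_mul_eq_mul_div, div_le_iff₀ (by linarith)]
    nlinarith
  linarith

/-- The increments of `f` over open subintervals of `[c, d]` are approximated by those of
`∫ h dg`, with an error controlled by the oscillation of `h` and the monotone function `M`. -/
def Ctrl (M : ℝ → ℝ) (c d : ℝ) (g f h : SidedFun) : Prop :=
  ∀ x y, c ≤ x → x < y → y ≤ d → ∀ k ε, (∀ z ∈ Ioo x y, |h.avg z - k| ≤ ε) →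
    |f.l y - f.r x - k * (g.l y - g.r x)| ≤ ε * (M y - M x)

section Ctrl

variable {M M' : ℝ → ℝ} {c d : ℝ} {g f h : SidedFun}

theorem Ctrl.add_right (H : Ctrl M c d g f h) (hM' : Monotone M') :
    Ctrl (fun x => M x + M' x) c d g f h := by
  intro x y hx hxy hy k ε hk
  have hε : 0 ≤ ε := by
    obtain ⟨z, hz⟩ := exists_between hxy
    exact (abs_nonneg _).trans (hk z hz)
  have := mul_nonneg hε (sub_nonneg.2 (hM' hxy.le))
  linarith [H x y hx hxy hy k ε hk]

theorem Ctrl.add_left (H : Ctrl M' c d g f h) (hM : Monotone M) :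
    Ctrl (fun x => M x + M' x) c d g f h := by
  simpa only [add_comm] using H.add_right hM

theorem Ctrl.eventually_right (H : Ctrl M c d g f h) {x : ℝ} (hx : x ∈ Ico c d) {k ε : ℝ}
    (hk : ∀ᶠ z in 𝓝[>] x, |h.avg z - k| ≤ ε) :
    ∀ᶠ y in 𝓝[>] x, |f.l y - f.r x - k * (g.l y - g.r x)| ≤ ε * (M y - M x) := by
  obtain ⟨z, hz, hz'⟩ := mem_nhdsGT_iff_exists_Ioo_subset.1 hk
  filter_upwards [Ioo_mem_nhdsGT hz, Ioo_mem_nhdsGT hx.2] with y h1 h2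
  exact H x y hx.1 h1.1 h2.2.le k ε fun t ht => hz' ⟨ht.1, ht.2.trans h1.2⟩

theorem Ctrl.eventually_left (H : Ctrl M c d g f h) {x : ℝ} (hx : x ∈ Ioc c d) {k ε : ℝ}
    (hk : ∀ᶠ z in 𝓝[<] x, |h.avg z - k| ≤ ε) :
    ∀ᶠ y in 𝓝[<] x, |f.r y - f.l x - k * (g.r y - g.l x)| ≤ ε * (M x - M y) := by
  obtain ⟨z, hz, hz'⟩ := mem_nhdsLT_iff_exists_Ioo_subset.1 hk
  filter_upwards [Ioo_mem_nhdsLT hz, Ioo_mem_nhdsLT hx.1] with y h1 h2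
  have := H y x h2.1.le h1.2 hx.2 k ε fun t ht => hz' ⟨h1.1.trans ht.1, ht.2⟩
  rw [← abs_neg] at this
  convert this using 2
  ring

theorem Ctrl.isLittleO_right (H : Ctrl M c d g f h) {x : ℝ} (hx : x ∈ Ico c d)
    (hh : Tendsto h.avg (𝓝[>] x) (𝓝 (h.r x))) :
    (fun y => f.l y - f.r x - h.r x * (g.l y - g.r x)) =o[𝓝[>] x] (fun y => M y - M x) := by
  rw [Asymptotics.isLittleO_iff]
  intro ε hε
  have := hh.eventually (Metric.closedBall_mem_nhds _ hε)
  filter_upwards [H.eventually_right hx this] with y hy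
  rw [Real.norm_eq_abs, Real.norm_eq_abs]
  exact hy.trans (mul_le_mul_of_nonneg_left (le_abs_self _) hε.le)

theorem Ctrl.isLittleO_left (H : Ctrl M c d g f h) {x : ℝ} (hx : x ∈ Ioc c d)
    (hh : Tendsto h.avg (𝓝[<] x) (𝓝 (h.l x))) :
    (fun y => f.r y - f.l x - h.l x * (g.r y - g.l x)) =o[𝓝[<] x] (fun y => M y - M x) := by
  rw [Asymptotics.isLittleO_iff]
  intro ε hε
  have := hh.eventually (Metric.closedBall_mem_nhds _ hε)
  filter_upwards [H.eventually_left hx this] with y hy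
  rw [Real.norm_eq_abs, Real.norm_eq_abs, abs_sub_comm (M y)]
  exact hy.trans (mul_le_mul_of_nonneg_left (le_abs_self _) hε.le)

theorem Ctrl.isBigO_right (H : Ctrl M c d g f h) {x : ℝ} (hx : x ∈ Ico c d)
    (hh : Tendsto h.avg (𝓝[>] x) (𝓝 (h.r x))) :
    (fun y => f.l y - f.r x) =O[𝓝[>] x] (fun y => M y - M x) := by
  have hk : ∀ᶠ z in 𝓝[>] x, |h.avg z - 0| ≤ |h.r x| + 1 := by
    filter_upwards [hh.eventually (Metric.closedBall_mem_nhds _ one_pos)] with z hz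
    rw [Real.dist_eq, abs_le] at hz
    rw [sub_zero, abs_le]
    constructor <;> linarith [hz.1, hz.2, neg_abs_le (h.r x), le_abs_self (h.r x)]
  refine Asymptotics.IsBigO.of_bound (|h.r x| + 1) ?_
  filter_upwards [H.eventually_right hx hk] with y hy
  rw [Real.norm_eq_abs, Real.norm_eq_abs]
  rw [zero_mul, sub_zero] at hy
  exact hy.trans (mul_le_mul_of_nonneg_left (le_abs_self _) (by positivity))

theorem Ctrl.isBigO_left (H : Ctrl M c d g f h) {x : ℝ} (hx : x ∈ Ioc c d)
    (hh : Tendsto h.avg (𝓝[<] x) (𝓝 (h.l x))) :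
    (fun y => f.r y - f.l x) =O[𝓝[<] x] (fun y => M y - M x) := by
  have hk : ∀ᶠ z in 𝓝[<] x, |h.avg z - 0| ≤ |h.l x| + 1 := by
    filter_upwards [hh.eventually (Metric.closedBall_mem_nhds _ one_pos)] with z hz
    rw [Real.dist_eq, abs_le] at hz
    rw [sub_zero, abs_le]
    constructor <;> linarith [hz.1, hz.2, neg_abs_le (h.l x), le_abs_self (h.l x)]
  refine Asymptotics.IsBigO.of_bound (|h.l x| + 1) ?_
  filter_upwards [H.eventually_left hx hk] with y hy
  rw [Real.norm_eq_abs, Real.norm_eq_abs, abs_sub_comm (M y)]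
  rw [zero_mul, sub_zero] at hy
  exact hy.trans (mul_le_mul_of_nonneg_left (le_abs_self _) (by positivity))

end Ctrl

/-- `df = h dg` on `I`, expressed through one-sided limits. -/
structure IsPrim (I : Set ℝ) (g f h : SidedFun) : Prop where
  jump : ∀ x ∈ I, f.r x - f.l x = h.avg x * (g.r x - g.l x)
  ctrl : ∀ c ∈ I, ∀ d ∈ I, c < d → ∃ M, Monotone M ∧ Ctrl M c d g f h

theorem IsPrim.neg {I : Set ℝ} {g f h : SidedFun} (H : IsPrim I g f h) :
    IsPrim I g f.neg h.neg := by
  refine ⟨fun x hx => ?_, fun c hc d hd hcd => ?_⟩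
  · have := H.jump x hx
    simp only [SidedFun.neg, avg] at this ⊢
    linear_combination -this
  · obtain ⟨M, hM, hc⟩ := H.ctrl c hc d hd hcd
    refine ⟨M, hM, fun x y hx hxy hy k ε hk => ?_⟩
    have := hc x y hx hxy hy (-k) ε fun z hz => by
      rw [← abs_neg]
      convert hk z hz using 2
      simp only [SidedFun.neg, avg]
      ring
    rw [← abs_neg] at this
    convert this using 2
    simp only [SidedFun.neg]
    ring

/-- Reflection of `df = h dg`, with the sign attached to `g` and `h`. -/
theorem IsPrim.refl {I : Set ℝ} {g f h : SidedFun} (H : IsPrim I g f h) :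
    IsPrim (Neg.neg ⁻¹' I) g.refl.neg f.refl h.refl.neg := by
  refine ⟨fun x hx => ?_, fun c hc d hd hcd => ?_⟩
  · have := H.jump (-x) hx
    simp only [SidedFun.neg, SidedFun.refl, avg] at this ⊢
    linear_combination -this
  · obtain ⟨M, hM, hc⟩ := H.ctrl (-d) hd (-c) hc (neg_lt_neg hcd)
    refine ⟨fun x => -M (-x), fun x y hxy => neg_le_neg (hM (neg_le_neg hxy)),
      fun x y hx hxy hy k ε hk => ?_⟩
    have := hc (-y) (-x) (neg_le_neg hy) (neg_lt_neg hxy) (neg_le_neg hx) (-k) ε fun z hz => by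
      rw [← abs_neg]
      convert hk (-z) ⟨by linarith [hz.2], by linarith [hz.1]⟩ using 2
      simp only [SidedFun.neg, SidedFun.refl, avg, neg_neg]
      ring
    rw [← abs_neg] at this
    convert this using 2
    · simp only [SidedFun.neg, SidedFun.refl]
      ring
    · ring

/-- Reflection of `df = h dg`, with the sign attached to `g` and `f`. -/
theorem IsPrim.refl' {I : Set ℝ} {g f h : SidedFun} (H : IsPrim I g f h) :
    IsPrim (Neg.neg ⁻¹' I) g.refl.neg f.refl.neg h.refl := by
  have := H.refl.neg
  simpa only [SidedFun.neg, neg_neg] using this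

/-- If `df = h dg` with `g` increasing and `m ≤ h`, then `m dg ≤ df`. -/
theorem IsPrim.mul_le_increment {I : Set ℝ} {g f h : SidedFun} (H : IsPrim I g f h)
    (hh : Reg I h) {c d m : ℝ} (hcd : c < d) (hI : Icc c d ⊆ I)
    (hg : ∀ x ∈ I, ∀ y ∈ I, x < y → g.r x ≤ g.l y) (hg' : ∀ x ∈ I, g.l x ≤ g.r x)
    (hr : ∀ x ∈ Ico c d, m ≤ h.r x) (hl : ∀ x ∈ Ioc c d, m ≤ h.l x) :
    m * (g.l d - g.r c) ≤ f.l d - f.r c := by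
  obtain ⟨M, hM, hc⟩ := H.ctrl c (hI (left_mem_Icc.2 hcd.le)) d (hI (right_mem_Icc.2 hcd.le)) hcd
  have key := le_of_local_increase
    (F := ⟨fun x => f.r x - m * g.r x, fun x => f.l x - m * g.l x⟩) hM hcd ?_ ?_ ?_
  · simp only at key
    linarith
  · intro x hx
    have hxI := hI (Ico_subset_Icc_self hx)
    refine ⟨_, hc.isLittleO_right hx (hh.avg_right hxI), ?_⟩
    filter_upwards [Ioo_mem_nhdsGT hx.2] with y hy
    have h1 := hg x hxI y (hI ⟨hx.1.trans hy.1.le, hy.2.le⟩) hy.1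
    have h2 := mul_nonneg (sub_nonneg.2 (hr x hx)) (sub_nonneg.2 h1)
    linarith
  · intro x hx
    have hxI := hI (Ioc_subset_Icc_self hx)
    refine ⟨_, hc.isLittleO_left hx (hh.avg_left hxI), ?_⟩
    filter_upwards [Ioo_mem_nhdsLT hx.1] with y hy
    have h1 := hg y (hI ⟨hy.1.le, hy.2.le.trans hx.2⟩) x hxI hy.2
    have h2 := mul_nonneg (sub_nonneg.2 (hl x hx)) (sub_nonneg.2 h1)
    linarith
  · intro x hx
    have hxI := hI (Ioo_subset_Icc_self hx)
    have h1 := H.jump x hxI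
    have h2 : m ≤ h.avg x := by
      simp only [avg]
      linarith [hr x (Ioo_subset_Ico_self hx), hl x (Ioo_subset_Ioc_self hx)]
    have h3 := mul_nonneg (sub_nonneg.2 h2) (sub_nonneg.2 (hg' x hxI))
    simp only
    linarith

/-- `ω = 1 - Δα Δβ / 4`. -/
def om (α β : SidedFun) (x : ℝ) : ℝ := 1 - (α.r x - α.l x) * (β.r x - β.l x) / 4

/-- `u`, with `w = du/dα`, solves `dw = u dβ` on the open interval `I`, where `α` is strictly
increasing and `ω` does not vanish. -/
structure IsSol (I : Set ℝ) (α β u w : SidedFun) : Prop where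
  isOpen : IsOpen I
  conn : OrdConnected I
  reg_u : Reg I u
  reg_w : Reg I w
  du : IsPrim I α u w
  dw : IsPrim I β w u
  om_ne : ∀ x ∈ I, om α β x ≠ 0
  strict : ∀ x ∈ I, ∀ y ∈ I, x < y → α.r x < α.l y
  jump_nonneg : ∀ x ∈ I, α.l x ≤ α.r x

theorem eventually_nhds_of_sides {x : ℝ} {P : ℝ → Prop} (hl : ∀ᶠ y in 𝓝[<] x, P y)
    (hr : ∀ᶠ y in 𝓝[>] x, P y) (hx : P x) : ∀ᶠ y in 𝓝 x, P y := by
  rw [← nhdsNE_sup_pure, ← nhdsLT_sup_nhdsGT]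
  exact eventually_sup.2 ⟨eventually_sup.2 ⟨hl, hr⟩, hx⟩

theorem om_refl (α β : SidedFun) (x : ℝ) : om α.refl.neg β.refl.neg x = om α β (-x) := by
  simp only [om, SidedFun.neg, SidedFun.refl]
  ring

theorem mem_Icc_subset_of_isOpen {I : Set ℝ} (hI : IsOpen I) {x : ℝ} (hx : x ∈ I) :
    ∃ d > x, Icc x d ⊆ I := by
  obtain ⟨δ, hδ, hδ'⟩ := Metric.isOpen_iff.1 hI x hx
  refine ⟨x + δ / 2, by linarith, fun y hy => hδ' ?_⟩
  rw [Real.ball_eq_Ioo]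
  exact ⟨by linarith [hy.1], by linarith [hy.2]⟩

namespace IsSol

variable {I : Set ℝ} {α β u w : SidedFun}

theorem neg (S : IsSol I α β u w) : IsSol I α β u.neg w.neg :=
  ⟨S.isOpen, S.conn, S.reg_u.neg, S.reg_w.neg, S.du.neg, S.dw.neg, S.om_ne, S.strict,
    S.jump_nonneg⟩

theorem refl (S : IsSol I α β u w) :
    IsSol (Neg.neg ⁻¹' I) α.refl.neg β.refl.neg u.refl w.refl.neg := by
  refine ⟨S.isOpen.preimage continuous_neg, ?_, S.reg_u.refl, S.reg_w.refl.neg, S.du.refl,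
    S.dw.refl', fun x hx => ?_, fun x hx y hy hxy => ?_, fun x hx => ?_⟩
  · exact ⟨fun x hx y hy z hz => S.conn.out hy hx ⟨neg_le_neg hz.2, neg_le_neg hz.1⟩⟩
  · rw [om_refl]
    exact S.om_ne _ hx
  · exact neg_lt_neg (S.strict (-y) hy (-x) hx (neg_lt_neg hxy))
  · exact neg_le_neg (S.jump_nonneg (-x) hx)

/-- The jump relation for `u` starting from the left limits. -/
theorem om_mul_right (S : IsSol I α β u w) {x : ℝ} (hx : x ∈ I) (h : u.l x = 0) :
    om α β x * u.r x = w.l x * (α.r x - α.l x) := by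
  have h1 := S.du.jump x hx
  have h2 := S.dw.jump x hx
  simp only [avg, om] at *
  rw [h] at h1 h2
  linear_combination h1 + (α.r x - α.l x) / 2 * h2

theorem right_zero_of_left_zero (S : IsSol I α β u w) {x : ℝ} (hx : x ∈ I) (h : u.l x = 0)
    (h' : w.l x = 0) : u.r x = 0 ∧ w.r x = 0 := by
  have h1 := S.om_mul_right hx h
  rw [h', zero_mul] at h1
  have h2 := (mul_eq_zero.1 h1).resolve_left (S.om_ne x hx)
  refine ⟨h2, ?_⟩
  have h3 := S.dw.jump x hx
  simpa [avg, h, h', h2] using h3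

theorem left_zero_of_right_zero (S : IsSol I α β u w) {x : ℝ} (hx : x ∈ I) (h : u.r x = 0)
    (h' : w.r x = 0) : u.l x = 0 ∧ w.l x = 0 := by
  have := S.refl.right_zero_of_left_zero (x := -x) (by simpa using hx)
    (by simpa [SidedFun.refl] using h) (by simpa [SidedFun.refl, SidedFun.neg] using h')
  simpa [SidedFun.refl, SidedFun.neg] using this

end IsSol

theorem Ctrl.abs_le_half {I : Set ℝ} {M : ℝ → ℝ} {c d y₀ K : ℝ} {g f h : SidedFun}
    (H : Ctrl M c d g f h) (hM : Monotone M) (hf : Reg I f) (hI : Icc c d ⊆ I) (hy₀ : y₀ ≤ d)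
    (h0 : f.r c = 0) (hK : ∀ z ∈ Ioo c y₀, |h.avg z| ≤ K)
    (hM' : ∀ z ∈ Ioo c y₀, M z - rightLim M c ≤ 1 / 2) :
    ∀ y ∈ Ioo c y₀, |f.r y| ≤ K / 2 ∧ |f.avg y| ≤ K / 2 := by
  have hl : ∀ y ∈ Ioo c y₀, |f.l y| ≤ K / 2 := by
    intro y hy
    have hcI : c ∈ I := hI ⟨le_rfl, (hy.1.trans hy.2).le.trans hy₀⟩
    have hlim : Tendsto (fun t => |f.l y - f.r t|) (𝓝[>] c) (𝓝 |f.l y - f.r c|) :=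
      (tendsto_const_nhds.sub (hf.rr c hcI)).abs
    rw [h0, sub_zero] at hlim
    refine le_of_tendsto hlim ?_
    filter_upwards [Ioo_mem_nhdsGT hy.1] with t ht
    have h1 := H t y ht.1.le ht.2 (hy.2.le.trans hy₀) 0 K fun z hz => by
      rw [sub_zero]
      exact hK z ⟨ht.1.trans hz.1, hz.2.trans hy.2⟩
    rw [zero_mul, sub_zero] at h1
    have h2 : M y - M t ≤ 1 / 2 := by linarith [hM.rightLim_le ht.1, hM' y hy]
    have h3 : 0 ≤ K := (abs_nonneg _).trans (hK y hy)
    nlinarith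
  have hr : ∀ y ∈ Ioo c y₀, |f.r y| ≤ K / 2 := by
    intro y hy
    refine le_of_tendsto (hf.lr y (hI ⟨hy.1.le, hy.2.le.trans hy₀⟩)).abs ?_
    filter_upwards [Ioo_mem_nhdsGT hy.2] with t ht
    exact hl t ⟨hy.1.trans ht.1, ht.2⟩
  refine fun y hy => ⟨hr y hy, ?_⟩
  have h1 := abs_le.1 (hl y hy)
  have h2 := abs_le.1 (hr y hy)
  simp only [avg]
  rw [abs_le]
  constructor <;> linarith [h1.1, h1.2, h2.1, h2.2]

namespace IsSol

variable {I : Set ℝ} {α β u w : SidedFun}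

theorem eventually_zero_right (S : IsSol I α β u w) {x : ℝ} (hx : x ∈ I) (h : u.r x = 0)
    (h' : w.r x = 0) : ∀ᶠ y in 𝓝[>] x, u.r y = 0 ∧ w.r y = 0 := by
  obtain ⟨d, hd, hI⟩ := mem_Icc_subset_of_isOpen S.isOpen hx
  have hdI := hI (right_mem_Icc.2 hd.le)
  obtain ⟨M₁, hM₁, H₁⟩ := S.du.ctrl x hx d hdI hd
  obtain ⟨M₂, hM₂, H₂⟩ := S.dw.ctrl x hx d hdI hd
  have H₁' := H₁.add_right hM₂
  have H₂' := H₂.add_left hM₁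
  have hM := hM₁.add hM₂
  change Monotone (fun x => M₁ x + M₂ x) at hM
  set M : ℝ → ℝ := fun x => M₁ x + M₂ x
  have e1 : ∀ᶠ y in 𝓝[>] x, M y - rightLim M x ≤ 1 / 2 := by
    filter_upwards [(hM.tendsto_rightLim x).eventually
      (eventually_le_nhds (show rightLim M x < rightLim M x + 1 / 2 by linarith))] with y hy
    linarith
  have e2 : ∀ᶠ y in 𝓝[>] x, |u.avg y| ≤ 1 := by
    have := (S.reg_u.avg_right hx).abs
    rw [h, abs_zero] at this
    exact this.eventually (eventually_le_nhds one_pos)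
  have e3 : ∀ᶠ y in 𝓝[>] x, |w.avg y| ≤ 1 := by
    have := (S.reg_w.avg_right hx).abs
    rw [h', abs_zero] at this
    exact this.eventually (eventually_le_nhds one_pos)
  obtain ⟨y₁, hy₁, hy₁'⟩ := mem_nhdsGT_iff_exists_Ioo_subset.1 (e1.and (e2.and e3))
  set y₀ := min y₁ d
  have hsub : Ioo x y₀ ⊆ Ioo x y₁ := Ioo_subset_Ioo_right (min_le_left _ _)
  have hy₀d : y₀ ≤ d := min_le_right _ _
  have hMy : ∀ z ∈ Ioo x y₀, M z - rightLim M x ≤ 1 / 2 := fun z hz => (hy₁' (hsub hz)).1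
  have key : ∀ n : ℕ, ∀ y ∈ Ioo x y₀, |u.avg y| ≤ (1 / 2) ^ n ∧ |w.avg y| ≤ (1 / 2) ^ n := by
    intro n
    induction n with
    | zero =>
      intro y hy
      simpa using (hy₁' (hsub hy)).2
    | succ n ih =>
      intro y hy
      have h1 := H₁'.abs_le_half hM S.reg_u hI hy₀d h (fun z hz => (ih z hz).2) hMy y hy
      have h2 := H₂'.abs_le_half hM S.reg_w hI hy₀d h' (fun z hz => (ih z hz).1) hMy y hy
      rw [pow_succ, mul_one_div]
      exact ⟨h1.2, h2.2⟩
  have hzero : ∀ a : ℝ, (∀ n : ℕ, |a| ≤ (1 / 2) ^ n / 2) → a = 0 := by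
    intro a ha
    have hlim : Tendsto (fun n : ℕ => (1 / 2 : ℝ) ^ n / 2) atTop (𝓝 (0 / 2)) :=
      (tendsto_pow_atTop_nhds_zero_of_lt_one (by norm_num) (by norm_num)).div_const 2
    rw [zero_div] at hlim
    exact abs_nonpos_iff.1 (ge_of_tendsto' hlim ha)
  filter_upwards [Ioo_mem_nhdsGT (show x < y₀ from lt_min hy₁ hd)] with y hy
  exact ⟨hzero _ fun n =>
      (H₁'.abs_le_half hM S.reg_u hI hy₀d h (fun z hz => (key n z hz).2) hMy y hy).1,
    hzero _ fun n =>
      (H₂'.abs_le_half hM S.reg_w hI hy₀d h' (fun z hz => (key n z hz).1) hMy y hy).1⟩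

theorem eventually_zero_left (S : IsSol I α β u w) {x : ℝ} (hx : x ∈ I) (h : u.l x = 0)
    (h' : w.l x = 0) : ∀ᶠ y in 𝓝[<] x, u.l y = 0 ∧ w.l y = 0 := by
  have := S.refl.eventually_zero_right (x := -x) (by simpa using hx)
    (by simpa [SidedFun.refl] using h) (by simpa [SidedFun.refl, SidedFun.neg] using h')
  simpa [SidedFun.refl, SidedFun.neg] using tendsto_neg_nhdsLT.eventually this

/-- A solution with vanishing initial data vanishes. -/
theorem eq_zero_of_zero (S : IsSol I α β u w) {x₀ : ℝ} (hx₀ : x₀ ∈ I) (h : u.r x₀ = 0)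
    (h' : w.r x₀ = 0) : ∀ x ∈ I, u.r x = 0 ∧ w.r x = 0 := by
  intro x hx
  refine (S.conn.isPreconnected.induction₂
    (fun x y => (u.r x = 0 ∧ w.r x = 0) ↔ (u.r y = 0 ∧ w.r y = 0)) ?_
    (fun _ _ _ _ _ _ h1 h2 => h1.trans h2) (fun _ _ _ _ h => h.symm) hx₀ hx).1 ⟨h, h'⟩
  clear hx x
  intro x hx
  rw [S.isOpen.nhdsWithin_eq hx]
  by_cases hz : u.r x = 0 ∧ w.r x = 0
  · have hz' := S.left_zero_of_right_zero hx hz.1 hz.2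
    refine eventually_nhds_of_sides ?_ ?_ Iff.rfl
    · filter_upwards [S.eventually_zero_left hx hz'.1 hz'.2,
        nhdsWithin_le_nhds (S.isOpen.mem_nhds hx)] with y hy hyI
      exact iff_of_true hz (S.right_zero_of_left_zero hyI hy.1 hy.2)
    · filter_upwards [S.eventually_zero_right hx hz.1 hz.2] with y hy
      exact iff_of_true hz hy
  · have hz' : ¬ (u.l x = 0 ∧ w.l x = 0) := fun h => hz (S.right_zero_of_left_zero hx h.1 h.2)
    refine eventually_nhds_of_sides ?_ ?_ Iff.rfl
    · rcases not_and_or.1 hz' with h1 | h1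
      · filter_upwards [(S.reg_u.rl x hx).eventually_ne h1] with y hy
        exact iff_of_false hz fun h => hy h.1
      · filter_upwards [(S.reg_w.rl x hx).eventually_ne h1] with y hy
        exact iff_of_false hz fun h => hy h.2
    · rcases not_and_or.1 hz with h1 | h1
      · filter_upwards [(S.reg_u.rr x hx).eventually_ne h1] with y hy
        exact iff_of_false hz fun h => hy h.1
      · filter_upwards [(S.reg_w.rr x hx).eventually_ne h1] with y hy
        exact iff_of_false hz fun h => hy h.2

end IsSol

/-- `(u, w)` vanishes nowhere on `I`. -/
def Nontriv (I : Set ℝ) (u w : SidedFun) : Prop :=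
  ∀ x ∈ I, ¬(u.r x = 0 ∧ w.r x = 0) ∧ ¬(u.l x = 0 ∧ w.l x = 0)

/-- `F` is positive immediately to the right of `x`. -/
def RPos (F : SidedFun) (x : ℝ) : Prop := ∀ᶠ y in 𝓝[>] x, 0 < F.r y

/-- `F` is positive immediately to the left of `x`. -/
def LPos (F : SidedFun) (x : ℝ) : Prop := ∀ᶠ y in 𝓝[<] x, 0 < F.l y

theorem refl_refl (F : SidedFun) : F.refl.refl = F := by
  simp only [SidedFun.refl, neg_neg]

theorem Nontriv.neg {I : Set ℝ} {u w : SidedFun} (H : Nontriv I u w) :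
    Nontriv I u.neg w.neg := by
  intro x hx
  simpa [SidedFun.neg] using H x hx

theorem Nontriv.refl {I : Set ℝ} {u w : SidedFun} (H : Nontriv I u w) :
    Nontriv (Neg.neg ⁻¹' I) u.refl w.refl.neg := by
  intro x hx
  simpa [SidedFun.neg, SidedFun.refl] using (H (-x) hx).symm

theorem rPos_refl {F : SidedFun} {x : ℝ} (h : LPos F x) : RPos F.refl (-x) :=
  tendsto_neg_nhdsGT_neg.eventually h

theorem lPos_refl {F : SidedFun} {x : ℝ} (h : RPos F x) : LPos F.refl (-x) :=
  tendsto_neg_nhdsLT_neg.eventually h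

theorem lPos_of_refl {F : SidedFun} {x : ℝ} (h : RPos F.refl (-x)) : LPos F x := by
  simpa [refl_refl] using lPos_refl h

theorem RPos.not_neg {F : SidedFun} {x : ℝ} (h : RPos F x) : ¬ RPos F.neg x := fun h' => by
  obtain ⟨y, h1, h2⟩ := (h.and h').exists
  exact lt_asymm h1 (neg_pos.1 h2)

theorem LPos.not_neg {F : SidedFun} {x : ℝ} (h : LPos F x) : ¬ LPos F.neg x := fun h' => by
  obtain ⟨y, h1, h2⟩ := (h.and h').exists
  exact lt_asymm h1 (neg_pos.1 h2)

section Reg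

variable {I : Set ℝ} {F : SidedFun} {x : ℝ}

theorem Reg.rPos (hF : Reg I F) (hx : x ∈ I) (h : 0 < F.r x) : RPos F x :=
  (hF.rr x hx).eventually (eventually_gt_nhds h)

theorem Reg.lPos (hF : Reg I F) (hx : x ∈ I) (h : 0 < F.l x) : LPos F x :=
  (hF.ll x hx).eventually (eventually_gt_nhds h)

theorem Reg.nonneg_of_rPos (hF : Reg I F) (hx : x ∈ I) (h : RPos F x) : 0 ≤ F.r x :=
  ge_of_tendsto (hF.rr x hx) (h.mono fun _ h => h.le)

theorem Reg.nonneg_of_lPos (hF : Reg I F) (hx : x ∈ I) (h : LPos F x) : 0 ≤ F.l x :=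
  ge_of_tendsto (hF.ll x hx) (h.mono fun _ h => h.le)

end Reg

namespace IsSol

variable {I : Set ℝ} {α β u w : SidedFun} {x : ℝ}

theorem rPos_of_zero (S : IsSol I α β u w) (hx : x ∈ I) (h : u.r x = 0) (h' : 0 < w.r x) :
    RPos u x := by
  obtain ⟨d, hd, hI⟩ := mem_Icc_subset_of_isOpen S.isOpen hx
  have hm : w.r x / 2 < w.r x := by linarith
  have e1 := (S.reg_w.rr x hx).eventually (eventually_gt_nhds hm)
  have e2 := (S.reg_w.lr x hx).eventually (eventually_gt_nhds hm)
  obtain ⟨y₁, hy₁, hy₁'⟩ := mem_nhdsGT_iff_exists_Ioo_subset.1 (e1.and e2)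
  filter_upwards [Ioo_mem_nhdsGT hy₁, Ioo_mem_nhdsGT hd] with y hy hy'
  have hyI : y ∈ I := hI ⟨hy'.1.le, hy'.2.le⟩
  have h1 := S.du.mul_le_increment S.reg_w (m := w.r x / 2) hy.1
    ((Icc_subset_Icc_right hy'.2.le).trans hI) (fun a ha b hb hab => (S.strict a ha b hb hab).le)
    S.jump_nonneg
    (fun z hz => by
      rcases hz.1.eq_or_lt with rfl | hz'
      · exact hm.le
      · exact (hy₁' ⟨hz', hz.2.trans hy.2⟩).1.le)
    (fun z hz => (hy₁' ⟨hz.1, hz.2.trans_lt hy.2⟩).2.le)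
  have h2 := mul_pos (half_pos h') (sub_pos.2 (S.strict x hx y hyI hy.1))
  have h3 := S.du.jump y hyI
  have h4 : 0 ≤ w.avg y := by
    have := hy₁' hy
    simp only [avg]
    linarith [this.1, this.2]
  have h5 := mul_nonneg h4 (sub_nonneg.2 (S.jump_nonneg y hyI))
  linarith

theorem lPos_of_zero (S : IsSol I α β u w) (hx : x ∈ I) (h : u.l x = 0) (h' : w.l x < 0) :
    LPos u x :=
  lPos_of_refl <| S.refl.rPos_of_zero (x := -x) (by simpa using hx)
    (by simpa [SidedFun.refl] using h) (by simpa [SidedFun.refl, SidedFun.neg] using h')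

theorem rPos_or (S : IsSol I α β u w) (hn : Nontriv I u w) (hx : x ∈ I) :
    RPos u x ∨ RPos u.neg x := by
  rcases lt_trichotomy (u.r x) 0 with h | h | h
  · exact Or.inr (S.reg_u.neg.rPos hx (neg_pos.2 h))
  · rcases lt_or_gt_of_ne (fun h' => (hn x hx).1 ⟨h, h'⟩) with h' | h'
    · exact Or.inr (S.neg.rPos_of_zero hx (neg_eq_zero.2 h) (neg_pos.2 h'))
    · exact Or.inl (S.rPos_of_zero hx h h')
  · exact Or.inl (S.reg_u.rPos hx h)

theorem lPos_or (S : IsSol I α β u w) (hn : Nontriv I u w) (hx : x ∈ I) :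
    LPos u x ∨ LPos u.neg x :=
  (S.refl.rPos_or hn.refl (x := -x) (by simpa using hx)).imp lPos_of_refl lPos_of_refl

theorem w_nonneg_of_rPos (S : IsSol I α β u w) (hx : x ∈ I) (h : u.r x = 0) (h' : RPos u x) :
    0 ≤ w.r x :=
  not_lt.1 fun hw => h'.not_neg (S.neg.rPos_of_zero hx (neg_eq_zero.2 h) (neg_pos.2 hw))

theorem w_nonpos_of_lPos (S : IsSol I α β u w) (hx : x ∈ I) (h : u.l x = 0) (h' : LPos u x) :
    w.l x ≤ 0 :=
  not_lt.1 fun hw => h'.not_neg (S.neg.lPos_of_zero hx (neg_eq_zero.2 h) (neg_neg_iff_pos.2 hw))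

/-- A solution positive to the right of a point where it vanishes from the left has positive
derivative there, provided `ω > 0`. -/
theorem w_pos_of_rPos (S : IsSol I α β u w) (hn : Nontriv I u w) (hx : x ∈ I) (h : u.l x = 0)
    (h' : RPos u x) (ho : 0 < om α β x) : 0 < w.l x := by
  have hne : w.l x ≠ 0 := fun h0 => (hn x hx).2 ⟨h, h0⟩
  refine (not_lt.1 fun hneg => ?_).lt_of_ne' hne
  have h1 := S.om_mul_right hx h
  have h2 := mul_nonneg ho.le (S.reg_u.nonneg_of_rPos hx h')
  have h3 := mul_nonneg (neg_nonneg.2 hneg.le) (sub_nonneg.2 (S.jump_nonneg x hx))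
  have h4 : om α β x * u.r x = 0 := by linarith
  have h5 : u.r x = 0 := (mul_eq_zero.1 h4).resolve_left ho.ne'
  have h6 := S.dw.jump x hx
  simp only [avg, h, h5, add_zero, zero_div, zero_mul] at h6
  linarith [S.w_nonneg_of_rPos hx h5 h']

theorem w_neg_of_lPos (S : IsSol I α β u w) (hn : Nontriv I u w) (hx : x ∈ I) (h : u.r x = 0)
    (h' : LPos u x) (ho : 0 < om α β x) : w.r x < 0 := by
  have := S.refl.w_pos_of_rPos hn.refl (x := -x) (by simpa using hx)
    (by simpa [SidedFun.refl] using h) (rPos_refl h') (by rw [om_refl]; simpa using ho)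
  simpa [SidedFun.refl, SidedFun.neg] using this

/-- A solution without sign changes on an interval has a constant sign there. -/
theorem constant_sign (S : IsSol I α β u w) (hn : Nontriv I u w) {J : Set ℝ} (hJ : J ⊆ I)
    (hpre : IsPreconnected J) (hno : ∀ x ∈ J, LPos u x ↔ RPos u x) :
    (∀ x ∈ J, LPos u x ∧ RPos u x) ∨ ∀ x ∈ J, LPos u.neg x ∧ RPos u.neg x := by
  have hnot : ∀ x ∈ J, ¬ RPos u x → LPos u.neg x ∧ RPos u.neg x := fun x hx h =>
    ⟨(S.lPos_or hn (hJ hx)).resolve_left (mt (hno x hx).1 h),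
      (S.rPos_or hn (hJ hx)).resolve_left h⟩
  rcases J.eq_empty_or_nonempty with rfl | ⟨x₀, hx₀⟩
  · exact Or.inl fun x hx => hx.elim
  have key : ∀ x ∈ J, RPos u x₀ ↔ RPos u x := by
    intro x hx
    refine hpre.induction₂ (fun x y => RPos u x ↔ RPos u y) ?_
      (fun _ _ _ _ _ _ h1 h2 => h1.trans h2) (fun _ _ _ _ h => h.symm) hx₀ hx
    clear hx x
    intro x hx
    suffices ∀ᶠ y in 𝓝 x, y ∈ J → (RPos u x ↔ RPos u y) from eventually_nhdsWithin_iff.2 this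
    have hIx := S.isOpen.mem_nhds (hJ hx)
    by_cases h : RPos u x
    · refine eventually_nhds_of_sides ?_ ?_ fun _ => Iff.rfl
      · filter_upwards [(hno x hx).2 h] with y hy hyJ
        exact iff_of_true h ((hno y hyJ).1 (S.reg_u.lPos (hJ hyJ) hy))
      · filter_upwards [h] with y hy hyJ
        exact iff_of_true h (S.reg_u.rPos (hJ hyJ) hy)
    · have h' := hnot x hx h
      refine eventually_nhds_of_sides ?_ ?_ fun _ => Iff.rfl
      · filter_upwards [h'.1] with y hy hyJ
        exact iff_of_false h fun h2 => (((hno y hyJ).2 h2).not_neg)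
          (S.reg_u.neg.lPos (hJ hyJ) hy)
      · filter_upwards [h'.2] with y hy hyJ
        exact iff_of_false h fun h2 => h2.not_neg (S.reg_u.neg.rPos (hJ hyJ) hy)
  by_cases h : RPos u x₀
  · exact Or.inl fun x hx => ⟨(hno x hx).2 ((key x hx).1 h), (key x hx).1 h⟩
  · exact Or.inr fun x hx => hnot x hx fun h2 => h ((key x hx).2 h2)

end IsSol

/-- The Wronskian `u (dv/dα) - (du/dα) v`. -/
def wr (u w v z : SidedFun) : SidedFun :=
  ⟨fun x => u.r x * z.r x - w.r x * v.r x, fun x => u.l x * z.l x - w.l x * v.l x⟩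

theorem wronskian_isLittleO {F : Filter ℝ} {N A B₁ B₂ du dw dv dz : ℝ → ℝ} {u₀ w₀ v₀ z₀ : ℝ}
    (hu : (fun y => du y - w₀ * A y) =o[F] N) (hw : (fun y => dw y - u₀ * B₁ y) =o[F] N)
    (hv : (fun y => dv y - z₀ * A y) =o[F] N) (hz : (fun y => dz y - v₀ * B₂ y) =o[F] N)
    (hu0 : Tendsto du F (𝓝 0)) (hw0 : Tendsto dw F (𝓝 0)) (hvO : dv =O[F] N)
    (hzO : dz =O[F] N) :
    (fun y => (u₀ + du y) * (z₀ + dz y) - (w₀ + dw y) * (v₀ + dv y) - (u₀ * z₀ - w₀ * v₀) -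
      u₀ * v₀ * (B₂ y - B₁ y)) =o[F] N := by
  have h1 : (fun y => du y * dz y) =o[F] N := by
    simpa using ((Asymptotics.isLittleO_one_iff ℝ).2 hu0).mul_isBigO hzO
  have h2 : (fun y => dw y * dv y) =o[F] N := by
    simpa using ((Asymptotics.isLittleO_one_iff ℝ).2 hw0).mul_isBigO hvO
  refine (((((hu.const_mul_left z₀).sub (hw.const_mul_left v₀)).sub
    (hv.const_mul_left w₀)).add (hz.const_mul_left u₀)).add (h1.sub h2)).congr_left fun y => ?_
  ring

section Wronskian

variable {I : Set ℝ} {α β₁ β₂ u w v z : SidedFun}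

theorem wr_jump (S : IsSol I α β₁ u w) (T : IsSol I α β₂ v z) {x : ℝ} (hx : x ∈ I) :
    (wr u w v z).r x - (wr u w v z).l x =
      u.avg x * v.avg x * ((β₂.r x - β₂.l x) - (β₁.r x - β₁.l x)) := by
  have h1 := S.du.jump x hx
  have h2 := S.dw.jump x hx
  have h3 := T.du.jump x hx
  have h4 := T.dw.jump x hx
  simp only [avg, wr] at *
  linear_combination ((z.r x + z.l x) / 2) * h1 - ((v.r x + v.l x) / 2) * h2 -
    ((w.r x + w.l x) / 2) * h3 + ((u.r x + u.l x) / 2) * h4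

/-- A quantitative form of `d(u (dv/dα) - (du/dα) v) = - u v d(β₁ - β₂)`. -/
theorem wr_le (S : IsSol I α β₁ u w) (T : IsSol I α β₂ v z) {c d p q : ℝ}
    (hcd : c < d) (hI : Icc c d ⊆ I) (hp : 0 ≤ p) (hq : 0 ≤ q)
    (hur : ∀ x ∈ Ico c d, p ≤ u.r x) (hul : ∀ x ∈ Ioc c d, p ≤ u.l x)
    (hvr : ∀ x ∈ Ico c d, q ≤ v.r x) (hvl : ∀ x ∈ Ioc c d, q ≤ v.l x)
    (hγ : ∀ x ∈ Icc c d, ∀ y ∈ Icc c d, x < y → β₂.l y - β₂.r x ≤ β₁.l y - β₁.r x)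
    (hγ' : ∀ x ∈ Ioo c d, β₂.r x - β₂.l x ≤ β₁.r x - β₁.l x) :
    (wr u w v z).l d + p * q * ((β₁.l d - β₁.r c) - (β₂.l d - β₂.r c)) ≤ (wr u w v z).r c := by
  have hcI := hI (left_mem_Icc.2 hcd.le)
  have hdI := hI (right_mem_Icc.2 hcd.le)
  obtain ⟨M₁, hM₁, H₁⟩ := S.du.ctrl c hcI d hdI hcd
  obtain ⟨M₂, hM₂, H₂⟩ := S.dw.ctrl c hcI d hdI hcd
  obtain ⟨M₃, hM₃, H₃⟩ := T.du.ctrl c hcI d hdI hcd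
  obtain ⟨M₄, hM₄, H₄⟩ := T.dw.ctrl c hcI d hdI hcd
  have H₁ := (H₁.add_right hM₂).add_right (hM₃.add hM₄)
  have H₂ := (H₂.add_left hM₁).add_right (hM₃.add hM₄)
  have H₃ := (H₃.add_right hM₄).add_left (hM₁.add hM₂)
  have H₄ := (H₄.add_left hM₃).add_left (hM₁.add hM₂)
  have hM := (hM₁.add hM₂).add (hM₃.add hM₄)
  change Monotone (fun x => M₁ x + M₂ x + (M₃ x + M₄ x)) at hM
  set M : ℝ → ℝ := fun x => M₁ x + M₂ x + (M₃ x + M₄ x)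
  have hpq : ∀ {a b : ℝ}, p ≤ a → q ≤ b → 0 ≤ a * b - p * q := fun ha hb =>
    sub_nonneg.2 (mul_le_mul ha hb hq (hp.trans ha))
  have key := le_of_local_increase
    (F := ⟨fun x => -(wr u w v z).r x - p * q * (β₁.r x - β₂.r x),
      fun x => -(wr u w v z).l x - p * q * (β₁.l x - β₂.l x)⟩) hM hcd ?_ ?_ ?_
  · simp only at key
    linarith
  · intro x hx
    have hxI := hI (Ico_subset_Icc_self hx)
    refine ⟨_, (wronskian_isLittleO (H₁.isLittleO_right hx (S.reg_w.avg_right hxI))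
      (H₂.isLittleO_right hx (S.reg_u.avg_right hxI))
      (H₃.isLittleO_right hx (T.reg_w.avg_right hxI))
      (H₄.isLittleO_right hx (T.reg_u.avg_right hxI))
      (by simpa using (S.reg_u.lr x hxI).sub_const (u.r x))
      (by simpa using (S.reg_w.lr x hxI).sub_const (w.r x))
      (H₃.isBigO_right hx (T.reg_w.avg_right hxI))
      (H₄.isBigO_right hx (T.reg_u.avg_right hxI))).neg_left, ?_⟩
    filter_upwards [Ioo_mem_nhdsGT hx.2] with y hy
    have h1 := hγ x (Ico_subset_Icc_self hx) y ⟨hx.1.trans hy.1.le, hy.2.le⟩ hy.1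
    have h2 := mul_nonneg (hpq (hur x hx) (hvr x hx)) (sub_nonneg.2 h1)
    simp only [wr]
    linarith
  · intro x hx
    have hxI := hI (Ioc_subset_Icc_self hx)
    refine ⟨_, (wronskian_isLittleO (H₁.isLittleO_left hx (S.reg_w.avg_left hxI))
      (H₂.isLittleO_left hx (S.reg_u.avg_left hxI))
      (H₃.isLittleO_left hx (T.reg_w.avg_left hxI))
      (H₄.isLittleO_left hx (T.reg_u.avg_left hxI))
      (by simpa using (S.reg_u.rl x hxI).sub_const (u.l x))
      (by simpa using (S.reg_w.rl x hxI).sub_const (w.l x))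
      (H₃.isBigO_left hx (T.reg_w.avg_left hxI))
      (H₄.isBigO_left hx (T.reg_u.avg_left hxI))).neg_left, ?_⟩
    filter_upwards [Ioo_mem_nhdsLT hx.1] with y hy
    have h1 := hγ y ⟨hy.1.le, hy.2.le.trans hx.2⟩ x (Ioc_subset_Icc_self hx) hy.2
    have h2 := mul_nonneg (hpq (hul x hx) (hvl x hx)) (sub_nonneg.2 h1)
    simp only [wr]
    linarith
  · intro x hx
    have h1 := wr_jump S T (hI (Ioo_subset_Icc_self hx))
    have h2 : p ≤ u.avg x := by
      simp only [avg]
      linarith [hur x (Ioo_subset_Ico_self hx), hul x (Ioo_subset_Ioc_self hx)]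
    have h3 : q ≤ v.avg x := by
      simp only [avg]
      linarith [hvr x (Ioo_subset_Ico_self hx), hvl x (Ioo_subset_Ioc_self hx)]
    have h4 := mul_nonneg (hpq h2 h3) (sub_nonneg.2 (hγ' x hx))
    simp only
    linarith

end Wronskian

theorem Reg.exists_pos_le {I : Set ℝ} {F : SidedFun} (hF : Reg I F) {c d : ℝ} (hI : Icc c d ⊆ I)
    (hpos : ∀ x ∈ Icc c d, 0 < F.r x ∧ 0 < F.l x) :
    ∃ p > 0, ∀ x ∈ Icc c d, p ≤ F.r x ∧ p ≤ F.l x := by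
  refine isCompact_Icc.induction_on (p := fun A => ∃ p > 0, ∀ x ∈ A, p ≤ F.r x ∧ p ≤ F.l x)
    ⟨1, one_pos, fun x hx => hx.elim⟩ ?_ ?_ ?_
  · rintro A B hAB ⟨p, hp, h⟩
    exact ⟨p, hp, fun x hx => h x (hAB hx)⟩
  · rintro A B ⟨p, hp, h⟩ ⟨q, hq, h'⟩
    refine ⟨min p q, lt_min hp hq, ?_⟩
    rintro x (hx | hx)
    · exact ⟨(min_le_left _ _).trans (h x hx).1, (min_le_left _ _).trans (h x hx).2⟩
    · exact ⟨(min_le_right _ _).trans (h' x hx).1, (min_le_right _ _).trans (h' x hx).2⟩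
  · intro x hx
    obtain ⟨hr, hl⟩ := hpos x hx
    set p := min (F.r x) (F.l x) / 2
    have hp : 0 < p := half_pos (lt_min hr hl)
    have hpr : p < F.r x := (half_lt_self (lt_min hr hl)).trans_le (min_le_left _ _)
    have hpl : p < F.l x := (half_lt_self (lt_min hr hl)).trans_le (min_le_right _ _)
    have hxI := hI hx
    have : ∀ᶠ y in 𝓝 x, p ≤ F.r y ∧ p ≤ F.l y := by
      refine eventually_nhds_of_sides ?_ ?_ ⟨hpr.le, hpl.le⟩
      · filter_upwards [(hF.rl x hxI).eventually (eventually_gt_nhds hpl),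
          (hF.ll x hxI).eventually (eventually_gt_nhds hpl)] with y h1 h2
        exact ⟨h1.le, h2.le⟩
      · filter_upwards [(hF.rr x hxI).eventually (eventually_gt_nhds hpr),
          (hF.lr x hxI).eventually (eventually_gt_nhds hpr)] with y h1 h2
        exact ⟨h1.le, h2.le⟩
    exact ⟨_, mem_nhdsWithin_of_mem_nhds this, p, hp, fun y hy => hy⟩

/-- `F` is positive in the one-sided sense throughout `(s, t)`, including the inner sides of the
endpoints. -/
def PosOn (F : SidedFun) (s t : ℝ) : Prop :=
  (∀ x ∈ Ico s t, RPos F x) ∧ ∀ x ∈ Ioc s t, LPos F x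

theorem IsSol.posOn {I : Set ℝ} {α β u w : SidedFun} (S : IsSol I α β u w)
    (hn : Nontriv I u w) {s t : ℝ} (hst : s < t) (hs : s ∈ I) (ht : t ∈ I)
    (h : ∀ x ∈ Ioo s t, LPos u x ∧ RPos u x) : PosOn u s t := by
  have hI : Icc s t ⊆ I := S.conn.out hs ht
  refine ⟨fun x hx => ?_, fun x hx => ?_⟩
  · rcases hx.1.eq_or_lt with rfl | hsx
    · refine (S.rPos_or hn hs).resolve_right fun h' => ?_
      obtain ⟨y, h1, h2⟩ := (h'.and (Ioo_mem_nhdsGT hst)).exists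
      exact (h y h2).2.not_neg (S.reg_u.neg.rPos (hI (Ioo_subset_Icc_self h2)) h1)
    · exact (h x ⟨hsx, hx.2⟩).2
  · rcases hx.2.eq_or_lt with rfl | hxt
    · refine (S.lPos_or hn ht).resolve_right fun h' => ?_
      obtain ⟨y, h1, h2⟩ := (h'.and (Ioo_mem_nhdsLT hst)).exists
      exact (h y h2).1.not_neg (S.reg_u.neg.lPos (hI (Ioo_subset_Icc_self h2)) h1)
    · exact (h x ⟨hx.1, hxt⟩).1

/-- A solution without zeros in `(s, t)` is positive there, up to the sign. -/
theorem IsSol.posOn_or {I : Set ℝ} {α β u w : SidedFun} (S : IsSol I α β u w)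
    (hn : Nontriv I u w) {s t : ℝ} (hst : s < t) (hs : s ∈ I) (ht : t ∈ I)
    (h : ∀ x ∈ Ioo s t, 0 < u.l x * u.r x) : PosOn u s t ∨ PosOn u.neg s t := by
  have hI : Ioo s t ⊆ I := Ioo_subset_Icc_self.trans (S.conn.out hs ht)
  refine (S.constant_sign hn hI isPreconnected_Ioo fun x hx => ?_).imp (S.posOn hn hst hs ht)
    (S.neg.posOn hn.neg hst hs ht)
  rcases pos_and_pos_or_neg_and_neg_of_mul_pos (h x hx) with h' | h'
  · exact iff_of_true (S.reg_u.lPos (hI hx) h'.1) (S.reg_u.rPos (hI hx) h'.2)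
  · exact iff_of_false
      (fun h2 => h2.not_neg (S.reg_u.neg.lPos (hI hx) (neg_pos.2 h'.1)))
      (fun h2 => h2.not_neg (S.reg_u.neg.rPos (hI hx) (neg_pos.2 h'.2)))

section Core

variable {I : Set ℝ} {α β₁ β₂ u w v z : SidedFun} {s t : ℝ}

theorem wr_le_of_posOn (S : IsSol I α β₁ u w) (T : IsSol I α β₂ v z) (hs : s ∈ I) (ht : t ∈ I)
    (hu : PosOn u s t) (hv : PosOn v s t)
    (hγ : ∀ x ∈ Icc s t, ∀ y ∈ Icc s t, x < y → β₂.l y - β₂.r x ≤ β₁.l y - β₁.r x)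
    (hγ' : ∀ x ∈ Ioo s t, β₂.r x - β₂.l x ≤ β₁.r x - β₁.l x)
    {c d : ℝ} (hsc : s ≤ c) (hcd : c < d) (hdt : d ≤ t) :
    (wr u w v z).l d ≤ (wr u w v z).r c := by
  have hsub := Icc_subset_Icc hsc hdt
  have hI : Icc c d ⊆ I := hsub.trans (S.conn.out hs ht)
  have := wr_le S T hcd hI le_rfl le_rfl
    (fun x hx => S.reg_u.nonneg_of_rPos (hI (Ico_subset_Icc_self hx))
      (hu.1 x ⟨hsc.trans hx.1, hx.2.trans_le hdt⟩))
    (fun x hx => S.reg_u.nonneg_of_lPos (hI (Ioc_subset_Icc_self hx))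
      (hu.2 x ⟨hsc.trans_lt hx.1, hx.2.trans hdt⟩))
    (fun x hx => T.reg_u.nonneg_of_rPos (hI (Ico_subset_Icc_self hx))
      (hv.1 x ⟨hsc.trans hx.1, hx.2.trans_le hdt⟩))
    (fun x hx => T.reg_u.nonneg_of_lPos (hI (Ioc_subset_Icc_self hx))
      (hv.2 x ⟨hsc.trans_lt hx.1, hx.2.trans hdt⟩))
    (fun x hx y hy => hγ x (hsub hx) y (hsub hy))
    (fun x hx => hγ' x ⟨hsc.trans_lt hx.1, hx.2.trans_le hdt⟩)
  simpa using this

theorem wr_jump_nonpos (S : IsSol I α β₁ u w) (T : IsSol I α β₂ v z) {x : ℝ} (hx : x ∈ I)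
    (hu : 0 ≤ u.avg x) (hv : 0 ≤ v.avg x) (hγ : β₂.r x - β₂.l x ≤ β₁.r x - β₁.l x) :
    (wr u w v z).r x ≤ (wr u w v z).l x := by
  have h1 := wr_jump S T hx
  have h2 := mul_nonneg (mul_nonneg hu hv) (sub_nonneg.2 hγ)
  linarith

theorem not_posOn_of_zero_inner (S : IsSol I α β₁ u w) (T : IsSol I α β₂ v z)
    (hnv : Nontriv I v z) (hst : s < t) (hs : s ∈ I) (ht : t ∈ I)
    (hβ₁ : Reg I β₁) (hβ₂ : Reg I β₂)
    (hup : ∀ x ∈ Ioo s t, 0 < u.l x * u.r x) (hu : PosOn u s t)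
    (hγ : ∀ x ∈ Icc s t, ∀ y ∈ Icc s t, x < y → β₂.l y - β₂.r x ≤ β₁.l y - β₁.r x)
    (hγ' : ∀ x ∈ Ioo s t, β₂.r x - β₂.l x ≤ β₁.r x - β₁.l x)
    (hus : u.r s = 0) (hut : u.l t = 0)
    (hpos : β₂.l t - β₂.r s < β₁.l t - β₁.r s) : ¬ PosOn v s t := by
  intro hv
  have hI : Icc s t ⊆ I := S.conn.out hs ht
  have hsI : s ∈ Ico s t := ⟨le_rfl, hst⟩
  have htI : t ∈ Ioc s t := ⟨hst, le_rfl⟩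
  have W := fun {c d : ℝ} => wr_le_of_posOn S T hs ht hu hv hγ hγ' (c := c) (d := d)
  have Ws : (wr u w v z).r s ≤ 0 := by
    have := mul_nonneg (S.w_nonneg_of_rPos hs hus (hu.1 s hsI))
      (T.reg_u.nonneg_of_rPos hs (hv.1 s hsI))
    simp only [wr, hus]
    linarith
  have Wt : 0 ≤ (wr u w v z).l t := by
    have := mul_nonneg (neg_nonneg.2 (S.w_nonpos_of_lPos ht hut (hu.2 t htI)))
      (T.reg_u.nonneg_of_lPos ht (hv.2 t htI))
    simp only [wr, hut]
    linarith
  have nn : ∀ x ∈ Ioo s t, (0 ≤ u.l x ∧ 0 ≤ u.r x) ∧ (0 ≤ v.l x ∧ 0 ≤ v.r x) := fun x hx => by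
    have hxI := hI (Ioo_subset_Icc_self hx)
    exact ⟨⟨S.reg_u.nonneg_of_lPos hxI (hu.2 x (Ioo_subset_Ioc_self hx)),
      S.reg_u.nonneg_of_rPos hxI (hu.1 x (Ioo_subset_Ico_self hx))⟩,
      ⟨T.reg_u.nonneg_of_lPos hxI (hv.2 x (Ioo_subset_Ioc_self hx)),
      T.reg_u.nonneg_of_rPos hxI (hv.1 x (Ioo_subset_Ico_self hx))⟩⟩
  have W0 : ∀ x ∈ Ioo s t, (wr u w v z).r x = 0 ∧ (wr u w v z).l x = 0 := by
    intro x hx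
    have h1 := W hx.1.le hx.2 le_rfl
    have h2 := W le_rfl hx.1 hx.2.le
    have h3 := wr_jump_nonpos S T (hI (Ioo_subset_Icc_self hx))
      (by simp only [avg]; linarith [(nn x hx).1.1, (nn x hx).1.2])
      (by simp only [avg]; linarith [(nn x hx).2.1, (nn x hx).2.2]) (hγ' x hx)
    constructor <;> linarith
  have upos : ∀ x ∈ Ioo s t, 0 < u.r x ∧ 0 < u.l x := fun x hx =>
    ⟨(nn x hx).1.2.lt_of_ne' (right_ne_zero_of_mul (hup x hx).ne'),
      (nn x hx).1.1.lt_of_ne' (left_ne_zero_of_mul (hup x hx).ne')⟩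
  have vpos : ∀ x ∈ Ioo s t, 0 < v.r x ∧ 0 < v.l x := by
    intro x hx
    have hxI := hI (Ioo_subset_Icc_self hx)
    obtain ⟨h1, h2⟩ := W0 x hx
    refine ⟨(nn x hx).2.2.lt_of_ne' fun h => (hnv x hxI).1 ⟨h, ?_⟩,
      (nn x hx).2.1.lt_of_ne' fun h => (hnv x hxI).2 ⟨h, ?_⟩⟩
    · simp only [wr, h, mul_zero, sub_zero] at h1
      exact (mul_eq_zero.1 h1).resolve_left (upos x hx).1.ne'
    · simp only [wr, h, mul_zero, sub_zero] at h2
      exact (mul_eq_zero.1 h2).resolve_left (upos x hx).2.ne'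
  obtain ⟨m, hm⟩ := exists_between hst
  set ε := ((β₁.l t - β₁.r s) - (β₂.l t - β₂.r s)) / 2 with hε
  have hε0 : 0 < ε := by linarith
  obtain ⟨c, hc, hc'⟩ := ((((hβ₁.rr s hs).sub (hβ₂.rr s hs)).eventually (eventually_lt_nhds
    (show β₁.r s - β₂.r s < β₁.r s - β₂.r s + ε by linarith))).and (Ioo_mem_nhdsGT hm.1)).exists
  obtain ⟨d, hd, hd'⟩ := ((((hβ₁.ll t ht).sub (hβ₂.ll t ht)).eventually (eventually_gt_nhds
    (show β₁.l t - β₂.l t - ε < β₁.l t - β₂.l t by linarith))).and (Ioo_mem_nhdsLT hm.2)).exists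
  have hcd : c < d := hc'.2.trans hd'.1
  have hsub : Icc c d ⊆ Ioo s t := Icc_subset_Ioo hc'.1 hd'.2
  have hI' : Icc c d ⊆ I := hsub.trans (Ioo_subset_Icc_self.trans hI)
  obtain ⟨p, hp, hp'⟩ := S.reg_u.exists_pos_le hI' fun x hx => upos x (hsub hx)
  obtain ⟨q, hq, hq'⟩ := T.reg_u.exists_pos_le hI' fun x hx => vpos x (hsub hx)
  have hsub' : Icc c d ⊆ Icc s t := hsub.trans Ioo_subset_Icc_self
  have := wr_le S T hcd hI' hp.le hq.le
    (fun x hx => (hp' x (Ico_subset_Icc_self hx)).1)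
    (fun x hx => (hp' x (Ioc_subset_Icc_self hx)).2)
    (fun x hx => (hq' x (Ico_subset_Icc_self hx)).1)
    (fun x hx => (hq' x (Ioc_subset_Icc_self hx)).2)
    (fun x hx y hy => hγ x (hsub' hx) y (hsub' hy))
    (fun x hx => hγ' x (hsub (Ioo_subset_Icc_self hx)))
  rw [(W0 c (hsub ⟨le_rfl, hcd.le⟩)).1, (W0 d (hsub ⟨hcd.le, le_rfl⟩)).2] at this
  have h3 : 0 < p * q * ((β₁.l d - β₁.r c) - (β₂.l d - β₂.r c)) :=
    mul_pos (mul_pos hp hq) (by linarith)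
  linarith

theorem not_posOn_of_zero_outer (S : IsSol I α β₁ u w) (T : IsSol I α β₂ v z)
    (hnu : Nontriv I u w) (hnv : Nontriv I v z) (hst : s < t) (hs : s ∈ I) (ht : t ∈ I)
    (hu : PosOn u s t)
    (hγ : ∀ x ∈ Icc s t, ∀ y ∈ Icc s t, x < y → β₂.l y - β₂.r x ≤ β₁.l y - β₁.r x)
    (hγ' : ∀ x ∈ Ico s t, β₂.r x - β₂.l x ≤ β₁.r x - β₁.l x)
    (hus : u.l s = 0) (ho : 0 < om α β₁ s) (hvs : LPos v s)
    (hE : 0 ≤ (wr u w v z).l t) : ¬ PosOn v s t := by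
  intro hv
  have hsI : s ∈ Ico s t := ⟨le_rfl, hst⟩
  have h1 := wr_le_of_posOn S T hs ht hu hv hγ
    (fun x hx => hγ' x (Ioo_subset_Ico_self hx)) le_rfl hst le_rfl
  have h2 := wr_jump S T hs
  have hw := S.w_pos_of_rPos hnu hs hus (hu.1 s hsI) ho
  have hvl := T.reg_u.nonneg_of_lPos hs hvs
  have hvr := T.reg_u.nonneg_of_rPos hs (hv.1 s hsI)
  have hur := S.reg_u.nonneg_of_rPos hs (hu.1 s hsI)
  have hl : (wr u w v z).l s = -(w.l s * v.l s) := by simp only [wr, hus]; ring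
  have hΔ := sub_nonneg.2 (hγ' s hsI)
  have hav : 0 ≤ v.avg s := by simp only [avg]; linarith
  have hau : 0 ≤ u.avg s := by simp only [avg]; linarith
  have h3 := mul_nonneg (mul_nonneg hau hav) hΔ
  have h4 := mul_nonneg hw.le hvl
  have h5 : w.l s * v.l s = 0 := by linarith
  have hvl0 : v.l s = 0 := (mul_eq_zero.1 h5).resolve_left hw.ne'
  have h6 : u.avg s * v.avg s * ((β₁.r s - β₁.l s) - (β₂.r s - β₂.l s)) = 0 := by linarith
  have ho₂ : 0 < om α β₂ s := by
    rcases mul_eq_zero.1 h6 with h7 | h7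
    · have hα : α.r s - α.l s = 0 := by
        rcases mul_eq_zero.1 h7 with h8 | h8
        · have h9 := S.om_mul_right hs hus
          have h10 : u.r s = 0 := by simp only [avg] at h8; linarith
          rw [h10, mul_zero] at h9
          exact (mul_eq_zero.1 h9.symm).resolve_left hw.ne'
        · have h9 := T.om_mul_right hs hvl0
          have h10 : v.r s = 0 := by simp only [avg] at h8; linarith
          rw [h10, mul_zero] at h9
          exact (mul_eq_zero.1 h9.symm).resolve_left fun h11 => (hnv s hs).2 ⟨hvl0, h11⟩
      simp only [om, hα]
      norm_num
    · simp only [om] at ho ⊢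
      rwa [← sub_eq_zero.1 h7]
  have := T.w_pos_of_rPos hnv hs hvl0 (hv.1 s hsI) ho₂
  exact absurd (T.w_nonpos_of_lPos hs hvl0 hvs) (not_le.2 this)

/-- Both endpoints are zeros of `u` from inside `(s, t)`: `v` changes sign in `(s, t)`. -/
theorem sturm_inner_inner (S : IsSol I α β₁ u w) (T : IsSol I α β₂ v z)
    (hnu : Nontriv I u w) (hnv : Nontriv I v z) (hst : s < t) (hs : s ∈ I) (ht : t ∈ I)
    (hβ₁ : Reg I β₁) (hβ₂ : Reg I β₂)
    (hup : ∀ x ∈ Ioo s t, 0 < u.l x * u.r x)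
    (hγ : ∀ x ∈ Icc s t, ∀ y ∈ Icc s t, x < y → β₂.l y - β₂.r x ≤ β₁.l y - β₁.r x)
    (hγ' : ∀ x ∈ Ioo s t, β₂.r x - β₂.l x ≤ β₁.r x - β₁.l x)
    (hus : u.r s = 0) (hut : u.l t = 0)
    (hpos : β₂.l t - β₂.r s < β₁.l t - β₁.r s) :
    ¬ ∀ x ∈ Ioo s t, LPos v x ↔ RPos v x := by
  intro hno
  have hJ : Ioo s t ⊆ I := Ioo_subset_Icc_self.trans (S.conn.out hs ht)
  have key : ∀ {u w : SidedFun}, IsSol I α β₁ u w → PosOn u s t →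
      (∀ x ∈ Ioo s t, 0 < u.l x * u.r x) → u.r s = 0 → u.l t = 0 → False := by
    intro u w S hu hup hus hut
    rcases T.constant_sign hnv hJ isPreconnected_Ioo hno with h | h
    · exact not_posOn_of_zero_inner S T hnv hst hs ht hβ₁ hβ₂ hup hu hγ hγ' hus hut hpos
        (T.posOn hnv hst hs ht h)
    · exact not_posOn_of_zero_inner S T.neg hnv.neg hst hs ht hβ₁ hβ₂ hup hu hγ hγ' hus hut hpos
        (T.neg.posOn hnv.neg hst hs ht h)
  rcases S.posOn_or hnu hst hs ht hup with hu | hu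
  · exact key S hu hup hus hut
  · exact key S.neg hu (by simpa [SidedFun.neg] using hup) (neg_eq_zero.2 hus) (neg_eq_zero.2 hut)

/-- `u` vanishes at `s` from outside and at `t` from inside: `v` changes sign in `[s, t)`. -/
theorem sturm_outer_inner (S : IsSol I α β₁ u w) (T : IsSol I α β₂ v z)
    (hnu : Nontriv I u w) (hnv : Nontriv I v z) (hst : s < t) (hs : s ∈ I) (ht : t ∈ I)
    (hup : ∀ x ∈ Ioo s t, 0 < u.l x * u.r x)
    (hγ : ∀ x ∈ Icc s t, ∀ y ∈ Icc s t, x < y → β₂.l y - β₂.r x ≤ β₁.l y - β₁.r x)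
    (hγ' : ∀ x ∈ Ico s t, β₂.r x - β₂.l x ≤ β₁.r x - β₁.l x)
    (hus : u.l s = 0) (hut : u.l t = 0) (ho : 0 < om α β₁ s) :
    ¬ ∀ x ∈ Ico s t, LPos v x ↔ RPos v x := by
  intro hno
  have hJ : Ico s t ⊆ I := Ico_subset_Icc_self.trans (S.conn.out hs ht)
  have core : ∀ {u w v z : SidedFun}, IsSol I α β₁ u w → IsSol I α β₂ v z → Nontriv I u w →
      Nontriv I v z → PosOn u s t → u.l s = 0 → u.l t = 0 →
      ¬ ∀ x ∈ Ico s t, LPos v x ∧ RPos v x := by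
    intro u w v z S T hnu hnv hu hus hut hv
    have hv' := T.posOn hnv hst hs ht fun x hx => hv x (Ioo_subset_Ico_self hx)
    refine not_posOn_of_zero_outer S T hnu hnv hst hs ht hu hγ hγ' hus ho (hv s ⟨le_rfl, hst⟩).1
      ?_ hv'
    have := mul_nonneg (neg_nonneg.2 (S.w_nonpos_of_lPos ht hut (hu.2 t ⟨hst, le_rfl⟩)))
      (T.reg_u.nonneg_of_lPos ht (hv'.2 t ⟨hst, le_rfl⟩))
    simp only [wr, hut]
    linarith
  have hus' : u.neg.l s = 0 := neg_eq_zero.2 hus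
  have hutn : u.neg.l t = 0 := neg_eq_zero.2 hut
  rcases S.posOn_or hnu hst hs ht hup with hu | hu <;>
    rcases T.constant_sign hnv hJ isPreconnected_Ico hno with hv | hv
  · exact core S T hnu hnv hu hus hut hv
  · exact core S T.neg hnu hnv.neg hu hus hut hv
  · exact core S.neg T hnu.neg hnv hu hus' hutn hv
  · exact core S.neg T.neg hnu.neg hnv.neg hu hus' hutn hv

/-- Both endpoints are zeros of `u` from outside `(s, t)`: `v` changes sign in `[s, t]`. -/
theorem sturm_outer_outer (S : IsSol I α β₁ u w) (T : IsSol I α β₂ v z)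
    (hnu : Nontriv I u w) (hnv : Nontriv I v z) (hst : s < t) (hs : s ∈ I) (ht : t ∈ I)
    (hup : ∀ x ∈ Ioo s t, 0 < u.l x * u.r x)
    (hγ : ∀ x ∈ Icc s t, ∀ y ∈ Icc s t, x < y → β₂.l y - β₂.r x ≤ β₁.l y - β₁.r x)
    (hγ' : ∀ x ∈ Icc s t, β₂.r x - β₂.l x ≤ β₁.r x - β₁.l x)
    (hus : u.l s = 0) (hut : u.r t = 0) (ho : 0 < om α β₁ s) (ho' : 0 < om α β₁ t) :
    ¬ ∀ x ∈ Icc s t, LPos v x ↔ RPos v x := by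
  intro hno
  have hJ : Icc s t ⊆ I := S.conn.out hs ht
  have core : ∀ {u w v z : SidedFun}, IsSol I α β₁ u w → IsSol I α β₂ v z → Nontriv I u w →
      Nontriv I v z → PosOn u s t → u.l s = 0 → u.r t = 0 →
      ¬ ∀ x ∈ Icc s t, LPos v x ∧ RPos v x := by
    intro u w v z S T hnu hnv hu hus hut hv
    have hv' := T.posOn hnv hst hs ht fun x hx => hv x (Ioo_subset_Icc_self hx)
    refine not_posOn_of_zero_outer S T hnu hnv hst hs ht hu hγ
      (fun x hx => hγ' x (Ico_subset_Icc_self hx)) hus ho (hv s ⟨le_rfl, hst.le⟩).1 ?_ hv'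
    obtain ⟨hvl, hvr⟩ := hv t ⟨hst.le, le_rfl⟩
    have hvl := T.reg_u.nonneg_of_lPos ht hvl
    have hvr := T.reg_u.nonneg_of_rPos ht hvr
    have hutn := hu.2 t ⟨hst, le_rfl⟩
    have hul := S.reg_u.nonneg_of_lPos ht hutn
    have h1 := wr_jump_nonpos S T ht (by simp only [avg]; linarith)
      (by simp only [avg]; linarith) (hγ' t ⟨hst.le, le_rfl⟩)
    refine le_trans ?_ h1
    have := mul_nonneg (neg_nonneg.2 (S.w_neg_of_lPos hnu ht hut hutn ho').le) hvr
    simp only [wr, hut]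
    linarith
  have hus' : u.neg.l s = 0 := neg_eq_zero.2 hus
  have hutn : u.neg.r t = 0 := neg_eq_zero.2 hut
  rcases S.posOn_or hnu hst hs ht hup with hu | hu <;>
    rcases T.constant_sign hnv hJ isPreconnected_Icc hno with hv | hv
  · exact core S T hnu hnv hu hus hut hv
  · exact core S T.neg hnu hnv.neg hu hus hut hv
  · exact core S.neg T hnu.neg hnv hu hus' hutn hv
  · exact core S.neg T.neg hnu.neg hnv.neg hu hus' hutn hv

/-- `u` vanishes at `s` from inside and at `t` from outside: `v` changes sign in `(s, t]`. -/
theorem sturm_inner_outer (S : IsSol I α β₁ u w) (T : IsSol I α β₂ v z)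
    (hnu : Nontriv I u w) (hnv : Nontriv I v z) (hst : s < t) (hs : s ∈ I) (ht : t ∈ I)
    (hup : ∀ x ∈ Ioo s t, 0 < u.l x * u.r x)
    (hγ : ∀ x ∈ Icc s t, ∀ y ∈ Icc s t, x < y → β₂.l y - β₂.r x ≤ β₁.l y - β₁.r x)
    (hγ' : ∀ x ∈ Ioc s t, β₂.r x - β₂.l x ≤ β₁.r x - β₁.l x)
    (hus : u.r s = 0) (hut : u.r t = 0) (ho : 0 < om α β₁ t) :
    ¬ ∀ x ∈ Ioc s t, LPos v x ↔ RPos v x := by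
  intro hno
  have mem : ∀ {x : ℝ}, x ∈ Icc (-t) (-s) → -x ∈ Icc s t := fun hx =>
    ⟨le_neg.2 hx.2, neg_le.2 hx.1⟩
  refine sturm_outer_inner S.refl T.refl hnu.refl hnv.refl (neg_lt_neg hst)
    (by simpa using ht) (by simpa using hs) (fun x hx => ?_) (fun x hx y hy hxy => ?_)
    (fun x hx => ?_) (by simpa [SidedFun.refl] using hut) (by simpa [SidedFun.refl] using hus)
    (by rw [om_refl]; simpa using ho) fun x hx => ?_
  · rw [mul_comm]
    exact hup (-x) ⟨lt_neg.2 hx.2, neg_lt.2 hx.1⟩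
  · have := hγ (-y) (mem hy) (-x) (mem hx) (neg_lt_neg hxy)
    simp only [SidedFun.neg, SidedFun.refl]
    linarith
  · have := hγ' (-x) ⟨lt_neg.2 hx.2, neg_le.2 hx.1⟩
    simp only [SidedFun.neg, SidedFun.refl]
    linarith
  · have := hno (-x) ⟨lt_neg.2 hx.2, neg_le.2 hx.1⟩
    constructor
    · intro h
      have h1 := rPos_refl h
      rw [refl_refl] at h1
      have h2 := rPos_refl (this.2 h1)
      rwa [neg_neg] at h2
    · intro h
      have h1 := lPos_refl h
      rw [refl_refl] at h1
      have h2 := lPos_refl (this.1 h1)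
      rwa [neg_neg] at h2

end Core

/-- The one-sided limits of a function. -/
def lr (f : ℝ → ℝ) : SidedFun := ⟨rightLim f, leftLim f⟩

/-- `f` has one-sided limits at all points of `I`. -/
def HasLims (I : Set ℝ) (f : ℝ → ℝ) : Prop :=
  ∀ x ∈ I, Tendsto f (𝓝[<] x) (𝓝 (leftLim f x)) ∧ Tendsto f (𝓝[>] x) (𝓝 (rightLim f x))

theorem hasLims_of_locallyBoundedVariationOn {I : Set ℝ} {f : ℝ → ℝ} (hI : IsOpen I)
    (hf : LocallyBoundedVariationOn f I) : HasLims I f := by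
  intro x hx
  obtain ⟨δ, hδ, hsub⟩ := Metric.isOpen_iff.1 hI x hx
  rw [Real.ball_eq_Ioo] at hsub
  have hc : x - δ / 2 ∈ I := hsub ⟨by linarith, by linarith⟩
  have hd : x + δ / 2 ∈ I := hsub ⟨by linarith, by linarith⟩
  have hbv : BoundedVariationOn f (I ∩ Icc (x - δ / 2) (x + δ / 2)) := hf _ _ hc hd
  have hnhds : I ∩ Icc (x - δ / 2) (x + δ / 2) ∈ 𝓝 x :=
    inter_mem (hI.mem_nhds hx) (Icc_mem_nhds (by linarith) (by linarith))
  refine ⟨tendsto_leftLim_of_tendsto ?_, tendsto_rightLim_of_tendsto ?_⟩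
  · obtain ⟨l, hl⟩ := hbv.exists_tendsto_left x
    rw [nhdsWithin_inter_of_mem (mem_nhdsWithin_of_mem_nhds hnhds)] at hl
    exact ⟨l, hl⟩
  · obtain ⟨l, hl⟩ := hbv.exists_tendsto_right x
    rw [nhdsWithin_inter_of_mem (mem_nhdsWithin_of_mem_nhds hnhds)] at hl
    exact ⟨l, hl⟩

/-- Taking limits of a function along finer filters does not change the limit. -/
theorem tendsto_of_tendsto_nearby {s : Set ℝ} (hs : IsOpen s) {x L : ℝ} {f g : ℝ → ℝ}
    {F : ℝ → Filter ℝ} [∀ y, (F y).NeBot] (hF : ∀ y, F y ≤ 𝓝 y)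
    (h : Tendsto f (𝓝[s] x) (𝓝 L)) (hg : ∀ᶠ y in 𝓝[s] x, Tendsto f (F y) (𝓝 (g y))) :
    Tendsto g (𝓝[s] x) (𝓝 L) := by
  refine (closed_nhds_basis L).tendsto_right_iff.2 fun U ⟨hU, hUc⟩ => ?_
  filter_upwards [eventually_eventually_nhdsWithin.2 (h.eventually hU), hg,
    self_mem_nhdsWithin] with y h1 h2 h3
  rw [hs.nhdsWithin_eq h3] at h1
  exact hUc.mem_of_tendsto h2 (hF y h1)

theorem HasLims.reg {I : Set ℝ} {f : ℝ → ℝ} (hI : IsOpen I) (hf : HasLims I f) :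
    Reg I (lr f) := by
  have hL : ∀ y : ℝ, 𝓝[<] y ≤ 𝓝 y := fun y => nhdsWithin_le_nhds
  have hR : ∀ y : ℝ, 𝓝[>] y ≤ 𝓝 y := fun y => nhdsWithin_le_nhds
  have ev : ∀ (s : Set ℝ), ∀ x ∈ I, ∀ᶠ y in 𝓝[s] x, y ∈ I := fun s x hx =>
    nhdsWithin_le_nhds (hI.mem_nhds hx)
  refine ⟨fun x hx => ?_, fun x hx => ?_, fun x hx => ?_, fun x hx => ?_⟩
  · exact tendsto_of_tendsto_nearby isOpen_Ioi hR (hf x hx).2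
      ((ev _ x hx).mono fun y hy => (hf y hy).2)
  · exact tendsto_of_tendsto_nearby isOpen_Ioi hL (hf x hx).2
      ((ev _ x hx).mono fun y hy => (hf y hy).1)
  · exact tendsto_of_tendsto_nearby isOpen_Iio hR (hf x hx).1
      ((ev _ x hx).mono fun y hy => (hf y hy).2)
  · exact tendsto_of_tendsto_nearby isOpen_Iio hL (hf x hx).1
      ((ev _ x hx).mono fun y hy => (hf y hy).1)

section SMRepresents

variable {I : Set ℝ} {ν : SignedMeasure ℝ} {f : ℝ → ℝ} {c d : ℝ}

theorem _root_.SMRepresents.apply_singleton (H : SMRepresents ν f c d) (hf : Reg I (lr f)) {x : ℝ}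
    (hxI : x ∈ I) (hx : x ∈ Ioc c d) : ν {x} = rightLim f x - leftLim f x := by
  obtain ⟨a, a_mono, a_mem, a_lim⟩ := exists_seq_strictMono_tendsto' hx.1
  have A : {x} = ⋂ n, Ioc (a n) x := by
    refine Subset.antisymm (fun y hy => ?_) fun y hy => ?_
    · rw [mem_singleton_iff.1 hy]
      exact mem_iInter.2 fun n => ⟨(a_mem n).2, le_rfl⟩
    · rw [mem_iInter] at hy
      exact le_antisymm (hy 0).2 (le_of_tendsto' a_lim fun n => (hy n).1.le)
  have L1 : Tendsto (fun n => ν (Ioc (a n) x)) atTop (𝓝 (ν {x})) := by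
    rw [A]
    exact VectorMeasure.tendsto_vectorMeasure_iInter_atTop_nat
      (fun m n hmn => Ioc_subset_Ioc_left (a_mono.monotone hmn)) fun n => measurableSet_Ioc
  have L2 : Tendsto (fun n => ν (Ioc (a n) x)) atTop (𝓝 (rightLim f x - leftLim f x)) := by
    have : ∀ n, ν (Ioc (a n) x) = rightLim f x - rightLim f (a n) := fun n =>
      H _ ⟨(a_mem n).1.le, (a_mem n).2.le.trans hx.2⟩ _ ⟨hx.1.le, hx.2⟩ (a_mem n).2.le
    simp_rw [this]
    exact tendsto_const_nhds.sub ((hf.rl x hxI).comp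
      (tendsto_nhdsWithin_of_tendsto_nhds_of_eventually_within _ a_lim
        (Eventually.of_forall fun n => (a_mem n).2)))
  exact tendsto_nhds_unique L1 L2

theorem _root_.SMRepresents.apply_Ioo (H : SMRepresents ν f c d) (hf : Reg I (lr f)) {x y : ℝ}
    (hyI : y ∈ I) (hx : c ≤ x) (hxy : x < y) (hy : y ≤ d) :
    ν (Ioo x y) = leftLim f y - rightLim f x := by
  have h1 := H x ⟨hx, hxy.le.trans hy⟩ y ⟨hx.trans hxy.le, hy⟩ hxy.le
  rw [← Ioo_union_right hxy, VectorMeasure.of_union (by simp) measurableSet_Ioo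
    (measurableSet_singleton y), H.apply_singleton hf hyI ⟨hx.trans_lt hxy, hy⟩] at h1
  linarith

end SMRepresents

theorem sInt_singleton (ν : SignedMeasure ℝ) (h : ℝ → ℝ) (x : ℝ) :
    sInt ν h {x} = h x * ν {x} := by
  rw [sInt, integral_singleton, integral_singleton,
    ν.apply_eq_posPart_real_sub_negPart_real (measurableSet_singleton x), smul_eq_mul, smul_eq_mul]
  ring

theorem setIntegral_sub_const_le {μ : Measure ℝ} [IsFiniteMeasure μ] {h : ℝ → ℝ} {E : Set ℝ}
    (hE : MeasurableSet E) (hm : ∀ μ : Measure ℝ, AEMeasurable h (μ.restrict E)) {k ε : ℝ}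
    (hk : ∀ z ∈ E, |h z - k| ≤ ε) : |(∫ x in E, h x ∂μ) - k * μ.real E| ≤ ε * μ.real E := by
  have hint : IntegrableOn h E μ := by
    refine Integrable.of_bound (hm μ).aestronglyMeasurable (|k| + ε) ?_
    refine (ae_restrict_iff' hE).2 (Eventually.of_forall fun z hz => ?_)
    rw [Real.norm_eq_abs]
    have := abs_add_le (h z - k) k
    rw [sub_add_cancel] at this
    linarith [hk z hz]
  have h1 : (∫ x in E, h x ∂μ) - k * μ.real E = ∫ x in E, (h x - k) ∂μ := by
    rw [integral_sub hint (integrable_const k), setIntegral_const, smul_eq_mul, mul_comm]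
  rw [h1, ← Real.norm_eq_abs]
  exact norm_setIntegral_le_of_norm_le_const (measure_lt_top _ _) hk

theorem sInt_sub_const_le {ν : SignedMeasure ℝ} {h : ℝ → ℝ} {E : Set ℝ}
    (hE : MeasurableSet E) (hm : ∀ μ : Measure ℝ, AEMeasurable h (μ.restrict E)) {k ε : ℝ}
    (hk : ∀ z ∈ E, |h z - k| ≤ ε) :
    |sInt ν h E - k * ν E| ≤ ε * (ν.toJordanDecomposition.posPart.real E +
      ν.toJordanDecomposition.negPart.real E) := by
  rw [ν.apply_eq_posPart_real_sub_negPart_real hE, sInt]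
  have h1 := setIntegral_sub_const_le (μ := ν.toJordanDecomposition.posPart) hE hm hk
  have h2 := setIntegral_sub_const_le (μ := ν.toJordanDecomposition.negPart) hE hm hk
  rw [abs_le] at *
  constructor <;> linarith [h1.1, h1.2, h2.1, h2.2]

theorem measureReal_Ioo_le (μ : Measure ℝ) [IsFiniteMeasure μ] {x y : ℝ} (hxy : x < y) :
    μ.real (Ioo x y) ≤ μ.real (Iic y) - μ.real (Iic x) := by
  rw [← measureReal_sdiff (Iic_subset_Iic.2 hxy.le) measurableSet_Iic]
  exact measureReal_mono fun z hz => ⟨hz.2.le, not_le.2 hz.1⟩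

theorem isPrim_of_measureEqOn {I : Set ℝ} (hI : IsOpen I) (hc : OrdConnected I) {f g h : ℝ → ℝ}
    (H : MeasureEqOn I f (fun _ : Fin 1 => h) (fun _ => g)) (hf : Reg I (lr f))
    (hg : Reg I (lr g)) (hh : LocallyBoundedVariationOn h I)
    (hbal : ∀ x ∈ I, h x = (lr h).avg x) : IsPrim I (lr g) (lr f) (lr h) := by
  have hm : ∀ E ⊆ I, MeasurableSet E → ∀ μ : Measure ℝ, AEMeasurable h (μ.restrict E) := by
    intro E hEI hE μ
    obtain ⟨p, q, hp, hq, rfl⟩ := hh.exists_monotoneOn_sub_monotoneOn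
    exact (aemeasurable_restrict_of_monotoneOn hE (hp.mono hEI)).sub
      (aemeasurable_restrict_of_monotoneOn hE (hq.mono hEI))
  refine ⟨fun x hx => ?_, fun c hcI d hdI hcd => ?_⟩
  · obtain ⟨δ, hδ, hsub⟩ := Metric.isOpen_iff.1 hI x hx
    rw [Real.ball_eq_Ioo] at hsub
    obtain ⟨νf, ν, h1, h2, h3⟩ := H (x - δ / 2) (hsub ⟨by linarith, by linarith⟩) x hx
      (by linarith)
    have hxm : x ∈ Ioc (x - δ / 2) x := ⟨by linarith, le_rfl⟩
    have := h3 {x} (singleton_subset_iff.2 hxm) (measurableSet_singleton x)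
    rw [Fin.sum_univ_one, sInt_singleton, h1.apply_singleton hf hx hxm,
      (h2 0).apply_singleton hg hx hxm] at this
    rw [← hbal x hx]
    exact this
  · obtain ⟨νf, ν, h1, h2, h3⟩ := H c hcI d hdI hcd
    set P := (ν 0).toJordanDecomposition.posPart
    set N := (ν 0).toJordanDecomposition.negPart
    refine ⟨fun y => P.real (Iic y) + N.real (Iic y), fun x y hxy =>
      add_le_add (measureReal_mono (Iic_subset_Iic.2 hxy)) (measureReal_mono (Iic_subset_Iic.2 hxy)),
      fun x y hx hxy hy k ε hk => ?_⟩
    have hsub : Ioo x y ⊆ Ioc c d := fun z hz => ⟨hx.trans_lt hz.1, hz.2.le.trans hy⟩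
    have hsubI : Ioo x y ⊆ I := hsub.trans (Ioc_subset_Icc_self.trans (hc.out hcI hdI))
    have hyI : y ∈ I := hc.out hcI hdI ⟨hx.trans hxy.le, hy⟩
    have h4 := h3 _ hsub measurableSet_Ioo
    rw [Fin.sum_univ_one, h1.apply_Ioo hf hyI hx hxy hy] at h4
    have h5 := sInt_sub_const_le (ν := ν 0) measurableSet_Ioo (hm _ hsubI measurableSet_Ioo)
      (fun z hz => by rw [hbal z (hsubI hz)]; exact hk z hz)
    rw [(h2 0).apply_Ioo hg hyI hx hxy hy, ← h4] at h5
    have hε : 0 ≤ ε := by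
      obtain ⟨z, hz⟩ := exists_between hxy
      exact (abs_nonneg _).trans (hk z hz)
    refine h5.trans (mul_le_mul_of_nonneg_left ?_ hε)
    have h6 := measureReal_Ioo_le P hxy
    have h7 := measureReal_Ioo_le N hxy
    simp only [P, N] at *
    linarith

theorem _root_.isOpen_EI (a b : EReal) : IsOpen (EI a b) :=
  (isOpen_Ioo (a := a) (b := b)).preimage continuous_coe_real_ereal

theorem _root_.ordConnected_EI (a b : EReal) : OrdConnected (EI a b) :=
  ⟨fun _ hx _ hy _ hz => ⟨hx.1.trans_le (EReal.coe_le_coe_iff.2 hz.1),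
    (EReal.coe_le_coe_iff.2 hz.2).trans_lt hy.2⟩⟩

theorem _root_.RBalanced.eq_avg {I : Set ℝ} {f : ℝ → ℝ} (hf : RBalanced (1 / 2) I f) :
    ∀ x ∈ I, f x = (lr f).avg x := by
  intro x hx
  rw [hf.2 x hx, avg, lr]
  ring

section StrictMono

variable {I : Set ℝ} {α : ℝ → ℝ} {x y : ℝ}

theorem leftLim_le_of_monotoneOn (hI : IsOpen I) (hα : MonotoneOn α I) (hl : HasLims I α)
    (hx : x ∈ I) : leftLim α x ≤ α x := by
  refine le_of_tendsto (hl x hx).1 ?_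
  filter_upwards [nhdsWithin_le_nhds (hI.mem_nhds hx), self_mem_nhdsWithin] with y hy hyx
  exact hα hy hx (le_of_lt hyx)

theorem le_rightLim_of_monotoneOn (hI : IsOpen I) (hα : MonotoneOn α I) (hl : HasLims I α)
    (hx : x ∈ I) : α x ≤ rightLim α x := by
  refine ge_of_tendsto (hl x hx).2 ?_
  filter_upwards [nhdsWithin_le_nhds (hI.mem_nhds hx), self_mem_nhdsWithin] with y hy hyx
  exact hα hx hy (le_of_lt hyx)

theorem rightLim_lt_leftLim_of_strictMonoOn (hI : IsOpen I) (hc : OrdConnected I)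
    (hα : StrictMonoOn α I) (hl : HasLims I α) (hx : x ∈ I) (hy : y ∈ I) (hxy : x < y) :
    rightLim α x < leftLim α y := by
  obtain ⟨p, hxp, hpy⟩ := exists_between hxy
  obtain ⟨q, hpq, hqy⟩ := exists_between hpy
  have hp : p ∈ I := hc.out hx hy ⟨hxp.le, hpy.le⟩
  have hq : q ∈ I := hc.out hx hy ⟨(hxp.trans hpq).le, hqy.le⟩
  have h1 : rightLim α x ≤ α p := by
    refine le_of_tendsto (hl x hx).2 ?_
    filter_upwards [nhdsWithin_le_nhds (hI.mem_nhds hx), Ioo_mem_nhdsGT hxp] with z hz hzp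
    exact hα.monotoneOn hz hp hzp.2.le
  have h2 : α q ≤ leftLim α y := by
    refine ge_of_tendsto (hl y hy).1 ?_
    filter_upwards [nhdsWithin_le_nhds (hI.mem_nhds hy), Ioo_mem_nhdsLT hqy] with z hz hzq
    exact hα.monotoneOn hq hz hzq.1.le
  exact h1.trans_lt ((hα hp hq hpq).trans_le h2)

end StrictMono

theorem _root_.IsHomSol.isSol {I : Set ℝ} (hI : IsOpen I) (hc : OrdConnected I)
    {α β u w : ℝ → ℝ} (hα : StrictMonoOn α I) (hβ : LocallyBoundedVariationOn β I)
    (hω : ∀ x ∈ I, omegaFn α β x ≠ 0) (hu : IsHomSol I (1 / 2) α β u w) :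
    IsSol I (lr α) (lr β) (lr u) (lr w) := by
  have hlα := hasLims_of_locallyBoundedVariationOn hI hα.monotoneOn.locallyBoundedVariationOn
  have hrβ := (hasLims_of_locallyBoundedVariationOn hI hβ).reg hI
  have hru := (hasLims_of_locallyBoundedVariationOn hI hu.1.1).reg hI
  have hrw := (hasLims_of_locallyBoundedVariationOn hI hu.2.1.1).reg hI
  refine ⟨hI, hc, hru, hrw,
    isPrim_of_measureEqOn hI hc hu.2.2.1 hru (hlα.reg hI) hu.2.1.1 hu.2.1.eq_avg,
    isPrim_of_measureEqOn hI hc hu.2.2.2 hrw hrβ hu.1.1 hu.1.eq_avg,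
    fun x hx => hω x hx,
    fun x hx y hy hxy => rightLim_lt_leftLim_of_strictMonoOn hI hc hα hlα hx hy hxy,
    fun x hx => (leftLim_le_of_monotoneOn hI hα.monotoneOn hlα hx).trans
      (le_rightLim_of_monotoneOn hI hα.monotoneOn hlα hx)⟩

theorem IsSol.nontriv {I : Set ℝ} {α β w : SidedFun} {u : ℝ → ℝ} (S : IsSol I α β (lr u) w)
    (hb : ∀ x ∈ I, u x = (lr u).avg x) (hn : ¬ ∀ x ∈ I, u x = 0) : Nontriv I (lr u) w := by
  have key : ∀ x ∈ I, ¬((lr u).r x = 0 ∧ w.r x = 0) := by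
    rintro x hx ⟨h1, h2⟩
    refine hn fun y hy => ?_
    have h3 := S.eq_zero_of_zero hx h1 h2 y hy
    rw [hb y hy, avg, h3.1, (S.left_zero_of_right_zero hy h3.1 h3.2).1, add_zero, zero_div]
  exact fun x hx => ⟨key x hx, fun h => key x hx (S.right_zero_of_left_zero hx h.1 h.2)⟩

theorem IsSol.lPos_iff_rPos {I : Set ℝ} {α β w : SidedFun} {v : ℝ → ℝ}
    (S : IsSol I α β (lr v) w) (hn : Nontriv I (lr v) w) {x : ℝ} (hx : x ∈ I)
    (h : ¬ ChangesSignAt I v x) : LPos (lr v) x ↔ RPos (lr v) x := by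
  obtain ⟨ε, hε, hsub⟩ := Metric.isOpen_iff.1 S.isOpen x hx
  rw [Real.ball_eq_Ioo] at hsub
  have key : ∀ {p q : ℝ → Prop}, (∀ᶠ y in 𝓝[<] x, p y) → (∀ᶠ y in 𝓝[>] x, q y) →
      ∃ δ > (0 : ℝ), Ioo (x - δ) (x + δ) ⊆ I ∧
        (∀ y ∈ Ioo (x - δ) x, p y) ∧ ∀ y ∈ Ioo x (x + δ), q y := by
    intro p q hp hq
    obtain ⟨c, hc, hcp⟩ := mem_nhdsLT_iff_exists_Ioo_subset.1 hp
    obtain ⟨d, hd, hdq⟩ := mem_nhdsGT_iff_exists_Ioo_subset.1 hq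
    have h1 : min ε (min (x - c) (d - x)) ≤ ε := min_le_left _ _
    have h2 : min ε (min (x - c) (d - x)) ≤ x - c := (min_le_right _ _).trans (min_le_left _ _)
    have h3 : min ε (min (x - c) (d - x)) ≤ d - x := (min_le_right _ _).trans (min_le_right _ _)
    refine ⟨min ε (min (x - c) (d - x)), lt_min hε (lt_min (sub_pos.2 hc) (sub_pos.2 hd)),
      fun y hy => hsub ⟨by linarith [hy.1], by linarith [hy.2]⟩,
      fun y hy => hcp ⟨by linarith [hy.1], hy.2⟩, fun y hy => hdq ⟨hy.1, by linarith [hy.2]⟩⟩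
  constructor
  · intro hl
    refine (S.rPos_or hn hx).resolve_right fun hr => h ?_
    obtain ⟨δ, hδ, h1, h2, h3⟩ := key hl hr
    exact ⟨δ, hδ, h1, Or.inr ⟨h2, fun y hy => neg_pos.1 (h3 y hy)⟩⟩
  · intro hr
    refine (S.lPos_or hn hx).resolve_right fun hl => h ?_
    obtain ⟨δ, hδ, h1, h2, h3⟩ := key hl hr
    exact ⟨δ, hδ, h1, Or.inl ⟨fun y hy => neg_pos.1 (h2 y hy), h3⟩⟩

theorem _root_.PosMeasureOn.increments {I : Set ℝ} {f g : ℝ → ℝ} {S : Set ℝ} (hf : HasLims I f)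
    (hg : HasLims I g) (h : PosMeasureOn (fun x => f x - g x) S) :
    (∀ x ∈ I, ∀ y ∈ I, x < y → Ioo x y ⊆ S →
      (lr g).l y - (lr g).r x ≤ (lr f).l y - (lr f).r x) ∧
    ∀ x ∈ I, x ∈ S → (lr g).r x - (lr g).l x ≤ (lr f).r x - (lr f).l x := by
  refine ⟨fun x hx y hy hxy hS => ?_, fun x hx hS => ?_⟩
  · have := h.2.2.2 x y hxy hS
    rw [leftLim_eq_of_tendsto ((hf y hy).1.sub (hg y hy).1),
      rightLim_eq_of_tendsto ((hf x hx).2.sub (hg x hx).2)] at this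
    simp only [lr]
    linarith
  · have := h.1 x x le_rfl (by simpa using hS)
    rw [leftLim_eq_of_tendsto ((hf x hx).1.sub (hg x hx).1),
      rightLim_eq_of_tendsto ((hf x hx).2.sub (hg x hx).2)] at this
    simp only [lr]
    linarith

end SidedFun

/-- Sturm Comparison Theorem I, Theorem 6.3. -/
theorem statement17 (a b : EReal) (hab : a < b) (α β₁ β₂ : ℝ → ℝ)
    (hα : StrictMonoOn α (EI a b))
    (hβ₁ : LocallyBoundedVariationOn β₁ (EI a b))
    (hβ₂ : LocallyBoundedVariationOn β₂ (EI a b))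
    (hω : ∀ x ∈ EI a b, omegaFn α β₁ x ≠ 0 ∧ omegaFn α β₂ x ≠ 0)
    (u wu v wv : ℝ → ℝ)
    (hu : IsHomSol (EI a b) (1 / 2) α β₁ u wu)
    (hv : IsHomSol (EI a b) (1 / 2) α β₂ v wv)
    (hnu : ¬ ∀ x ∈ EI a b, u x = 0) (hnv : ¬ ∀ x ∈ EI a b, v x = 0)
    (s t : ℝ) (hst : s < t)
    (hs : s ∈ ZSet u (EI a b)) (ht : t ∈ ZSet u (EI a b))
    (hcons : ZSet u (Ioo s t) = ∅) :
    (rightLim u s = 0 → leftLim u t = 0 →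
      PosMeasureOn (fun x => β₁ x - β₂ x) (Ioo s t) →
      0 < leftLim (fun x => β₁ x - β₂ x) t - rightLim (fun x => β₁ x - β₂ x) s →
      ChangesSignIn (EI a b) v (Ioo s t)) ∧
    (leftLim u s = 0 → leftLim u t = 0 → 0 < omegaFn α β₁ s →
      PosMeasureOn (fun x => β₁ x - β₂ x) (Ico s t) →
      ChangesSignIn (EI a b) v (Ico s t)) ∧
    (rightLim u s = 0 → rightLim u t = 0 → 0 < omegaFn α β₁ t →
      PosMeasureOn (fun x => β₁ x - β₂ x) (Ioc s t) →
      ChangesSignIn (EI a b) v (Ioc s t)) ∧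
    (leftLim u s = 0 → rightLim u t = 0 → 0 < omegaFn α β₁ s → 0 < omegaFn α β₁ t →
      PosMeasureOn (fun x => β₁ x - β₂ x) (Icc s t) →
      ChangesSignIn (EI a b) v (Icc s t)) := by
  have hI : IsOpen (EI a b) := isOpen_EI a b
  have hc : OrdConnected (EI a b) := ordConnected_EI a b
  have S := hu.isSol hI hc hα hβ₁ fun x hx => (hω x hx).1
  have T := hv.isSol hI hc hα hβ₂ fun x hx => (hω x hx).2
  have hNu := S.nontriv hu.1.eq_avg hnu
  have hNv := T.nontriv hv.1.eq_avg hnv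
  have hl₁ := SidedFun.hasLims_of_locallyBoundedVariationOn hI hβ₁
  have hl₂ := SidedFun.hasLims_of_locallyBoundedVariationOn hI hβ₂
  have hsI : s ∈ EI a b := hs.1
  have htI : t ∈ EI a b := ht.1
  have hsub : Icc s t ⊆ EI a b := hc.out hsI htI
  have hup : ∀ x ∈ Ioo s t, 0 < (SidedFun.lr u).l x * (SidedFun.lr u).r x := fun x hx =>
    not_le.1 fun h => (eq_empty_iff_forall_notMem.1 hcons x) ⟨hx, h⟩
  have hinc : ∀ J : Set ℝ, Ioo s t ⊆ J → PosMeasureOn (fun x => β₁ x - β₂ x) J →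
      ∀ x ∈ Icc s t, ∀ y ∈ Icc s t, x < y →
        (SidedFun.lr β₂).l y - (SidedFun.lr β₂).r x ≤
          (SidedFun.lr β₁).l y - (SidedFun.lr β₁).r x := fun J hJ h x hx y hy hxy =>
    (h.increments hl₁ hl₂).1 x (hsub hx) y (hsub hy) hxy ((Ioo_subset_Ioo hx.1 hy.2).trans hJ)
  have hjump : ∀ J : Set ℝ, J ⊆ Icc s t → PosMeasureOn (fun x => β₁ x - β₂ x) J →
      ∀ x ∈ J, (SidedFun.lr β₂).r x - (SidedFun.lr β₂).l x ≤
        (SidedFun.lr β₁).r x - (SidedFun.lr β₁).l x := fun J hJ h x hx =>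
    (h.increments hl₁ hl₂).2 x (hsub (hJ hx)) hx
  have hchange : ∀ J : Set ℝ, J ⊆ Icc s t →
      (¬ ∀ x ∈ J, SidedFun.LPos (SidedFun.lr v) x ↔ SidedFun.RPos (SidedFun.lr v) x) →
      ChangesSignIn (EI a b) v J := fun J hJ h => by
    by_contra hn
    exact h fun x hx => T.lPos_iff_rPos hNv (hsub (hJ hx)) fun hx' => hn ⟨x, hx, hx'⟩
  refine ⟨fun h1 h2 hp hpos => hchange _ Ioo_subset_Icc_self ?_,
    fun h1 h2 ho hp => hchange _ Ico_subset_Icc_self ?_,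
    fun h1 h2 ho hp => hchange _ Ioc_subset_Icc_self ?_,
    fun h1 h2 ho ho' hp => hchange _ Subset.rfl ?_⟩
  · refine SidedFun.sturm_inner_inner S T hNu hNv hst hsI htI (hl₁.reg hI) (hl₂.reg hI) hup
      (hinc _ Subset.rfl hp) (hjump _ Ioo_subset_Icc_self hp) h1 h2 ?_
    rw [leftLim_eq_of_tendsto ((hl₁ t htI).1.sub (hl₂ t htI).1),
      rightLim_eq_of_tendsto ((hl₁ s hsI).2.sub (hl₂ s hsI).2)] at hpos
    simp only [SidedFun.lr]
    linarith
  · exact SidedFun.sturm_outer_inner S T hNu hNv hst hsI htI hup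
      (hinc _ Ioo_subset_Ico_self hp) (hjump _ Ico_subset_Icc_self hp) h1 h2 ho
  · exact SidedFun.sturm_inner_outer S T hNu hNv hst hsI htI hup
      (hinc _ Ioo_subset_Ioc_self hp) (hjump _ Ioc_subset_Icc_self hp) h1 h2 ho
  · exact SidedFun.sturm_outer_outer S T hNu hNv hst hsI htI hup
      (hinc _ Ioo_subset_Icc_self hp) (hjump _ Subset.rfl hp) h1 h2 ho ho'
end
end

section
/- Assume α is strictly increasing on (a,b), β₁, β₂ ∈ BV_loc((a,b),ℝ), and ω₁(x) ≠ 0 and ω₂(x) ≠ 0 for all x ∈ (a,b). Let u and v be nontrivial real-valued balanced solutions of −d(dy/dα) + y dβ₁ = 0 and −d(dy/dα) + y dβ₂ = 0 on (a,b), respectively. If for some s ∈ (a,b) the function v does not change sign at s and u^-(s) u^+(s) < 0, then v(s) · (du/dα)(s) · W̃[v,u](s) > 0. If, in addition, ω₁(s) > 0 and Δ_{dβ₁}(s) ≥ Δ_{dβ₂}(s), then v(s) · (du/dα)(s) · W̃^-[v,u](s) > 0 and v(s) · (du/dα)(s) · W̃^+[v,u](s) > 0. -/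
open Set Filter Function MeasureTheory Topology

noncomputable section

theorem isOpen_EI_s18 (a b : EReal) : IsOpen (EI a b) :=
  isOpen_Ioo.preimage continuous_coe_real_ereal

theorem ordConnected_EI_s18 (a b : EReal) : (EI a b).OrdConnected :=
  ⟨fun _ hx _ hy _ hz => ⟨hx.1.trans_le (EReal.coe_le_coe_iff.2 hz.1),
    (EReal.coe_le_coe_iff.2 hz.2).trans_lt hy.2⟩⟩

theorem exists_Icc_subset_of_isOpen {I : Set ℝ} (hI : IsOpen I) {x : ℝ} (hx : x ∈ I) :
    ∃ c d : ℝ, c < x ∧ x < d ∧ Icc c d ⊆ I := by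
  obtain ⟨ε, hε, h⟩ := Metric.nhds_basis_closedBall.mem_iff.1 (hI.mem_nhds hx)
  exact ⟨x - ε, x + ε, by linarith, by linarith, by rwa [Real.closedBall_eq_Icc] at h⟩

/-- A function of locally bounded variation on an open set has one-sided limits there. -/
theorem LocallyBoundedVariationOn.tendsto_leftLim_rightLim {I : Set ℝ} (hI : IsOpen I)
    {f : ℝ → ℝ} (hf : LocallyBoundedVariationOn f I) {x : ℝ} (hx : x ∈ I) :
    Tendsto f (𝓝[<] x) (𝓝 (leftLim f x)) ∧ Tendsto f (𝓝[>] x) (𝓝 (rightLim f x)) := by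
  obtain ⟨c, d, hc, hd, hcd⟩ := exists_Icc_subset_of_isOpen hI hx
  have hb := hf c d (hcd ⟨le_rfl, (hc.trans hd).le⟩) (hcd ⟨(hc.trans hd).le, le_rfl⟩)
  rw [inter_eq_right.2 hcd] at hb
  have hn : Icc c d ∈ 𝓝 x := Icc_mem_nhds hc hd
  obtain ⟨l, hl⟩ := hb.exists_tendsto_left x
  obtain ⟨r, hr⟩ := hb.exists_tendsto_right x
  rw [inter_comm, nhdsWithin_inter_of_mem' (nhdsWithin_le_nhds hn)] at hl hr
  exact ⟨tendsto_leftLim_of_tendsto ⟨l, hl⟩, tendsto_rightLim_of_tendsto ⟨r, hr⟩⟩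

theorem leftLim_rightLim_mem_of_eventually {f : ℝ → ℝ} {S : Set ℝ} (hS : IsClosed S) {x : ℝ}
    (h : ∀ᶠ y in 𝓝 x, f y ∈ S) : leftLim f x ∈ S ∧ rightLim f x ∈ S := by
  have key : ∀ {T : Set ℝ} {z : ℝ}, MapClusterPt z (𝓝[T] x) f → z ∈ S := fun {T z} hz => by
    refine hS.closure_subset_iff.2 subset_rfl (mem_closure_iff_frequently.2 ?_)
    refine Filter.frequently_iff.2 fun {U} hU => ?_
    obtain ⟨y, hyU, hyS⟩ :=
      ((hz.frequently hU).and_eventually (nhdsWithin_le_nhds h)).exists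
    exact ⟨f y, hyU, hyS⟩
  exact ⟨key (mapClusterPt_leftLim f x), key (mapClusterPt_rightLim f x)⟩

theorem tendsto_leftLim_rightLim_nhdsWithin {f : ℝ → ℝ} {T : Set ℝ} (hT : IsOpen T) {s z : ℝ}
    (h : Tendsto f (𝓝[T] s) (𝓝 z)) :
    Tendsto (leftLim f) (𝓝[T] s) (𝓝 z) ∧ Tendsto (rightLim f) (𝓝[T] s) (𝓝 z) := by
  have key : ∀ S ∈ 𝓝 z, IsClosed S → ∀ᶠ x in 𝓝[T] s, leftLim f x ∈ S ∧ rightLim f x ∈ S := by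
    intro S hS hSc
    filter_upwards [eventually_eventually_nhdsWithin.2 (h.eventually hS), self_mem_nhdsWithin]
      with x hx hxT
    rw [hT.nhdsWithin_eq hxT] at hx
    exact leftLim_rightLim_mem_of_eventually hSc hx
  exact ⟨(closed_nhds_basis z).tendsto_right_iff.2 fun S hS => (key S hS.1 hS.2).mono fun _ h => h.1,
    (closed_nhds_basis z).tendsto_right_iff.2 fun S hS => (key S hS.1 hS.2).mono fun _ h => h.2⟩

theorem SMRepresents.apply_singleton_s18 {ν : SignedMeasure ℝ} {f : ℝ → ℝ} {c d s : ℝ}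
    (h : SMRepresents ν f c d) (hcs : c < s) (hsd : s ≤ d)
    (hf : Tendsto f (𝓝[<] s) (𝓝 (leftLim f s))) : ν {s} = jump f s := by
  obtain ⟨u, hu, huc, hus⟩ := exists_seq_strictMono_tendsto' hcs
  have hInter : ⋂ n, Ioc (u n) s = {s} := by
    ext x
    simp only [mem_iInter, mem_Ioc, mem_singleton_iff]
    refine ⟨fun hx => le_antisymm (hx 0).2 (le_of_tendsto' hus fun n => (hx n).1.le), ?_⟩
    rintro rfl n
    exact ⟨(huc n).2, le_rfl⟩
  have h1 : Tendsto (fun n => ν (Ioc (u n) s)) atTop (𝓝 (ν {s})) := by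
    rw [← hInter]
    exact VectorMeasure.tendsto_vectorMeasure_iInter_atTop_nat
      (fun i j hij => Ioc_subset_Ioc_left (hu.monotone hij)) fun _ => measurableSet_Ioc
  have hus' : Tendsto u atTop (𝓝[<] s) :=
    tendsto_nhdsWithin_iff.2 ⟨hus, Eventually.of_forall fun n => (huc n).2⟩
  have h2 : Tendsto (fun n => rightLim f s - rightLim f (u n)) atTop
      (𝓝 (rightLim f s - leftLim f s)) :=
    ((tendsto_leftLim_rightLim_nhdsWithin isOpen_Iio hf).2.comp hus').const_sub _
  refine tendsto_nhds_unique h1 (h2.congr fun n => ?_)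
  exact (h _ ⟨(huc n).1.le, (huc n).2.le.trans hsd⟩ _ ⟨hcs.le, hsd⟩ (huc n).2.le).symm

theorem sInt_singleton (ν : SignedMeasure ℝ) (h : ℝ → ℝ) (s : ℝ) :
    sInt ν h {s} = h s * ν {s} := by
  rw [sInt, integral_singleton, integral_singleton,
    ν.apply_eq_posPart_real_sub_negPart_real (measurableSet_singleton s), smul_eq_mul, smul_eq_mul]
  ring

theorem abs_sInt_le (ν : SignedMeasure ℝ) {h : ℝ → ℝ} {E : Set ℝ} {C : ℝ}
    (hC : ∀ x ∈ E, |h x| ≤ C) : |sInt ν h E| ≤ C * ν.totalVariation.real E := by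
  have h1 := norm_setIntegral_le_of_norm_le_const
    (f := h) (measure_lt_top ν.toJordanDecomposition.posPart E) hC
  have h2 := norm_setIntegral_le_of_norm_le_const
    (f := h) (measure_lt_top ν.toJordanDecomposition.negPart E) hC
  rw [SignedMeasure.totalVariation, measureReal_add_apply, mul_add]
  exact (abs_sub _ _).trans (add_le_add h1 h2)

theorem MeasureEqOn.jump_eq {I : Set ℝ} (hI : IsOpen I) {f h β : ℝ → ℝ}
    (H : MeasureEqOn I f (fun _ : Fin 1 => h) (fun _ => β))
    (hf : LocallyBoundedVariationOn f I) (hβ : LocallyBoundedVariationOn β I)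
    {s : ℝ} (hs : s ∈ I) : jump f s = h s * jump β s := by
  obtain ⟨c, d, hc, hd, hcd⟩ := exists_Icc_subset_of_isOpen hI hs
  obtain ⟨νf, ν, h1, h2, h3⟩ := H c (hcd ⟨le_rfl, (hc.trans hd).le⟩) d
    (hcd ⟨(hc.trans hd).le, le_rfl⟩) (hc.trans hd)
  have h4 := h3 {s} (singleton_subset_iff.2 ⟨hc, hd.le⟩) (measurableSet_singleton s)
  rwa [h1.apply_singleton_s18 hc hd.le (hf.tendsto_leftLim_rightLim hI hs).1, Fin.sum_univ_one,
    sInt_singleton, (h2 0).apply_singleton_s18 hc hd.le (hβ.tendsto_leftLim_rightLim hI hs).1] at h4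

theorem RBalanced.eq_leftLim_rightLim {I : Set ℝ} {f : ℝ → ℝ} (hf : RBalanced (1 / 2) I f)
    {x : ℝ} (hx : x ∈ I) :
    leftLim f x = f x - jump f x / 2 ∧ rightLim f x = f x + jump f x / 2 := by
  have := hf.2 x hx
  unfold jump
  constructor <;> linarith

theorem tendsto_measureReal_inter_Ioo (μ : Measure ℝ) [IsFiniteMeasure μ] {T : Set ℝ}
    (hT : MeasurableSet T) {s : ℝ} (hs : s ∉ T) :
    Tendsto (fun n : ℕ => μ.real (T ∩ Ioo (s - 1 / ((n : ℝ) + 1)) (s + 1 / ((n : ℝ) + 1)))) atTop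
      (𝓝 0) := by
  have hInter : ⋂ n : ℕ, T ∩ Ioo (s - 1 / ((n : ℝ) + 1)) (s + 1 / ((n : ℝ) + 1)) = ∅ := by
    refine eq_empty_of_forall_notMem fun x hx => ?_
    rw [mem_iInter] at hx
    have hlim : Tendsto (fun n : ℕ => 1 / ((n : ℝ) + 1)) atTop (𝓝 0) :=
      tendsto_one_div_add_atTop_nhds_zero_nat
    have h1 : s ≤ x := le_of_tendsto' (by simpa using hlim.const_sub s) fun n => (hx n).2.1.le
    have h2 : x ≤ s := ge_of_tendsto' (by simpa using hlim.const_add s) fun n => (hx n).2.2.le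
    exact hs (le_antisymm h1 h2 ▸ (hx 0).1)
  have h := tendsto_measure_iInter_atTop (μ := μ)
    (s := fun n : ℕ => T ∩ Ioo (s - 1 / ((n : ℝ) + 1)) (s + 1 / ((n : ℝ) + 1)))
    (fun n => (hT.inter measurableSet_Ioo).nullMeasurableSet)
    (fun m n hmn => inter_subset_inter_right _ (Ioo_subset_Ioo
      (sub_le_sub_left (Nat.one_div_le_one_div hmn) _)
      (add_le_add_right (Nat.one_div_le_one_div hmn) _)))
    ⟨0, measure_ne_top _ _⟩
  rw [hInter, measure_empty] at h
  exact (ENNReal.tendsto_toReal ENNReal.zero_ne_top).comp h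

theorem eventually_forall_inter_Ioo {T : Set ℝ} {s : ℝ} {P : ℝ → Prop}
    (h : ∀ᶠ x in 𝓝[T] s, P x) :
    ∀ᶠ n : ℕ in atTop, ∀ x ∈ T ∩ Ioo (s - 1 / ((n : ℝ) + 1)) (s + 1 / ((n : ℝ) + 1)), P x := by
  obtain ⟨ε, hε, hP⟩ := Metric.eventually_nhds_iff_ball.1 (eventually_nhdsWithin_iff.1 h)
  filter_upwards [tendsto_one_div_add_atTop_nhds_zero_nat.eventually_lt_const hε] with n hn x hx
  refine hP x ?_ hx.1
  rw [Real.ball_eq_Ioo]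
  exact ⟨by linarith [hx.2.1], by linarith [hx.2.2]⟩

/-- If `df = h dν` with `|h| ≤ C` on a one-sided neighbourhood `J` of `s`, and `f → 0` at `s`
along `J`, then `|f| ≤ C |ν|(J)` on `J`. -/
theorem abs_le_of_measure_eq {f h : ℝ → ℝ} {νf ν : SignedMeasure ℝ} {c d s C : ℝ} {T J : Set ℝ}
    (hT : IsOpen T) [(𝓝[T] s).NeBot] (hJ : IsOpen J) (hJc : J.OrdConnected)
    (hJcd : J ⊆ Ioo c d) (hJT : J ∈ 𝓝[T] s) (hνf : SMRepresents νf f c d)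
    (heq : ∀ E : Set ℝ, E ⊆ Ioc c d → MeasurableSet E → νf E = sInt ν h E)
    (hf : RBalanced (1 / 2) J f) (hf0 : Tendsto f (𝓝[T] s) (𝓝 0))
    (hC : ∀ x ∈ J, |h x| ≤ C) : ∀ x ∈ J, |f x| ≤ C * ν.totalVariation.real J := by
  have hmono : ∀ x ∈ J, ∀ y ∈ J, x ≤ y →
      |rightLim f y - rightLim f x| ≤ C * ν.totalVariation.real J := by
    intro x hx y hy hxy
    have hsub : Ioc x y ⊆ J := Ioc_subset_Icc_self.trans (hJc.out hx hy)
    rw [← hνf x (Ioo_subset_Icc_self (hJcd hx)) y (Ioo_subset_Icc_self (hJcd hy)) hxy,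
      heq _ (hsub.trans (hJcd.trans Ioo_subset_Ioc_self)) measurableSet_Ioc]
    refine (abs_sInt_le ν fun z hz => hC z (hsub hz)).trans ?_
    exact mul_le_mul_of_nonneg_left (measureReal_mono hsub) ((abs_nonneg _).trans (hC x hx))
  have hright : ∀ x ∈ J, |rightLim f x| ≤ C * ν.totalVariation.real J := by
    intro x hx
    have hlim : Tendsto (fun y => |rightLim f x - rightLim f y|) (𝓝[T] s)
        (𝓝 |rightLim f x - 0|) :=
      ((tendsto_leftLim_rightLim_nhdsWithin hT hf0).2.const_sub _).abs
    rw [sub_zero] at hlim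
    refine le_of_tendsto hlim ?_
    filter_upwards [hJT] with y hy
    rcases le_total x y with hxy | hxy
    · rw [abs_sub_comm]; exact hmono x hx y hy hxy
    · exact hmono y hy x hx hxy
  intro x hx
  have hl := (tendsto_leftLim_rightLim_nhdsWithin isOpen_Iio
    (hf.1.tendsto_leftLim_rightLim hJ hx).1).2.abs
  have hleft : |leftLim f x| ≤ C * ν.totalVariation.real J :=
    le_of_tendsto hl (mem_of_superset (nhdsWithin_le_nhds (hJ.mem_nhds hx)) hright)
  rw [hf.2 x hx]
  have h1 := abs_le.1 hleft
  have h2 := abs_le.1 (hright x hx)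
  exact abs_le.2 ⟨by linarith, by linarith⟩

theorem RBalanced.mono {r : ℝ} {I J : Set ℝ} {f : ℝ → ℝ} (hf : RBalanced r I f) (hJI : J ⊆ I) :
    RBalanced r J f :=
  ⟨fun a b ha hb => (hf.1 a b (hJI ha) (hJI hb)).mono (inter_subset_inter_left _ hJI),
    fun x hx => hf.2 x (hJI hx)⟩

/-- One-sided local uniqueness for the homogeneous equation with zero initial data. -/
theorem IsHomSol.eventually_eq_zero {I T : Set ℝ} (hI : IsOpen I) {α β v w : ℝ → ℝ}
    (h : IsHomSol I (1 / 2) α β v w) {s : ℝ} (hs : s ∈ I) (hT : IsOpen T) (hTc : T.OrdConnected)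
    (hsT : s ∉ T) [(𝓝[T] s).NeBot] (hv : Tendsto v (𝓝[T] s) (𝓝 0))
    (hw : Tendsto w (𝓝[T] s) (𝓝 0)) : ∀ᶠ x in 𝓝[T] s, v x = 0 ∧ w x = 0 := by
  obtain ⟨hbv, hbw, hmv, hmw⟩ := h
  obtain ⟨c, d, hc, hd, hcd⟩ := exists_Icc_subset_of_isOpen hI hs
  have hcI : c ∈ I := hcd ⟨le_rfl, (hc.trans hd).le⟩
  have hdI : d ∈ I := hcd ⟨(hc.trans hd).le, le_rfl⟩
  obtain ⟨νv, να, hνv, -, heqv⟩ := hmv c hcI d hdI (hc.trans hd)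
  obtain ⟨νw, νβ, hνw, -, heqw⟩ := hmw c hcI d hdI (hc.trans hd)
  simp only [Fin.sum_univ_one] at heqv heqw
  have hsmall : ∀ {g : ℝ → ℝ}, Tendsto g (𝓝[T] s) (𝓝 0) → ∀ᶠ x in 𝓝[T] s, |g x| ≤ 1 :=
    fun hg => (hg.abs.eventually_lt_const (by simp)).mono fun _ h => h.le
  have hcd' : ∀ᶠ x in 𝓝[T] s, x ∈ Ioo c d := nhdsWithin_le_nhds (Ioo_mem_nhds hc hd)
  obtain ⟨n, hn1, hn2, hn3, hn4, hn5⟩ := ((eventually_forall_inter_Ioo hcd').and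
    ((eventually_forall_inter_Ioo (hsmall hv)).and ((eventually_forall_inter_Ioo (hsmall hw)).and
    (((tendsto_measureReal_inter_Ioo (να 0).totalVariation hT.measurableSet hsT).eventually_lt_const
      one_half_pos).and
    ((tendsto_measureReal_inter_Ioo (νβ 0).totalVariation hT.measurableSet hsT).eventually_lt_const
      one_half_pos))))).exists
  have hδ : (0 : ℝ) < 1 / ((n : ℝ) + 1) := Nat.one_div_pos_of_nat
  let J := T ∩ Ioo (s - 1 / ((n : ℝ) + 1)) (s + 1 / ((n : ℝ) + 1))
  have hJ : IsOpen J := hT.inter isOpen_Ioo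
  have hJc : J.OrdConnected := hTc.inter ordConnected_Ioo
  have hJT : J ∈ 𝓝[T] s := inter_mem self_mem_nhdsWithin
    (nhdsWithin_le_nhds (Ioo_mem_nhds (by linarith) (by linarith)))
  have hJI : J ⊆ I := fun x hx => hcd (Ioo_subset_Icc_self (hn1 x hx))
  have hpow : ∀ k : ℕ, ∀ x ∈ J, |v x| ≤ (1 / 2) ^ k ∧ |w x| ≤ (1 / 2) ^ k := by
    intro k
    induction k with
    | zero => exact fun x hx => ⟨by simpa using hn2 x hx, by simpa using hn3 x hx⟩
    | succ k ih =>
      intro x hx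
      have hp : (0 : ℝ) ≤ (1 / 2) ^ k := by positivity
      refine ⟨(abs_le_of_measure_eq hT hJ hJc hn1 hJT hνv heqv (hbv.mono hJI) hv
        (fun y hy => (ih y hy).2) x hx).trans ?_,
        (abs_le_of_measure_eq hT hJ hJc hn1 hJT hνw heqw (hbw.mono hJI) hw
        (fun y hy => (ih y hy).1) x hx).trans ?_⟩ <;> rw [pow_succ]
      · exact mul_le_mul_of_nonneg_left hn4.le hp
      · exact mul_le_mul_of_nonneg_left hn5.le hp
  have hzero : ∀ {t : ℝ}, (∀ k : ℕ, |t| ≤ (1 / 2) ^ k) → t = 0 := fun {t} ht =>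
    abs_nonpos_iff.1 (ge_of_tendsto' (tendsto_pow_atTop_nhds_zero_of_lt_one (r := (1 / 2 : ℝ))
      (by norm_num) (by norm_num)) ht)
  filter_upwards [hJT] with x hx
  exact ⟨hzero fun k => (hpow k x hx).1, hzero fun k => (hpow k x hx).2⟩

theorem IsHomSol.jump_eq {I : Set ℝ} (hI : IsOpen I) {r : ℝ} {α β v w : ℝ → ℝ}
    (h : IsHomSol I r α β v w) (hα : LocallyBoundedVariationOn α I)
    (hβ : LocallyBoundedVariationOn β I) {x : ℝ} (hx : x ∈ I) :
    jump v x = w x * jump α x ∧ jump w x = v x * jump β x :=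
  ⟨h.2.2.1.jump_eq hI h.1.1 hα hx, h.2.2.2.jump_eq hI h.2.1.1 hβ hx⟩

/-- Uniqueness for the homogeneous equation with zero initial data. -/
theorem IsHomSol.eq_zero_of_initial {I : Set ℝ} (hI : IsOpen I) (hIc : I.OrdConnected)
    {α β v w : ℝ → ℝ} (h : IsHomSol I (1 / 2) α β v w) (hα : LocallyBoundedVariationOn α I)
    (hβ : LocallyBoundedVariationOn β I) (hω : ∀ x ∈ I, omegaFn α β x ≠ 0)
    {s : ℝ} (hs : s ∈ I) (hvs : v s = 0) (hws : w s = 0) : ∀ x ∈ I, v x = 0 := by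
  have hlim : ∀ {f : ℝ → ℝ}, RBalanced (1 / 2) I f → ∀ {x : ℝ}, x ∈ I →
      Tendsto f (𝓝[<] x) (𝓝 (f x - jump f x / 2)) ∧
      Tendsto f (𝓝[>] x) (𝓝 (f x + jump f x / 2)) := fun {f} hf x hx => by
    obtain ⟨h1, h2⟩ := hf.eq_leftLim_rightLim hx
    rw [← h1, ← h2]
    exact hf.1.tendsto_leftLim_rightLim hI hx
  let U := {x | x ∈ I ∧ v x = 0 ∧ w x = 0}
  have hUo : IsOpen U := by
    refine isOpen_iff_mem_nhds.2 fun x ⟨hx, hvx, hwx⟩ => ?_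
    obtain ⟨h1, h2⟩ := h.jump_eq hI hα hβ hx
    have hv' := hlim h.1 hx
    have hw' := hlim h.2.1 hx
    simp only [h1, h2, hvx, hwx, zero_mul, zero_div, sub_zero, add_zero] at hv' hw'
    have hl := h.eventually_eq_zero hI hx isOpen_Iio ordConnected_Iio self_notMem_Iio hv'.1 hw'.1
    have hr := h.eventually_eq_zero hI hx isOpen_Ioi ordConnected_Ioi self_notMem_Ioi hv'.2 hw'.2
    filter_upwards [hI.mem_nhds hx, eventually_nhdsWithin_iff.1 hl, eventually_nhdsWithin_iff.1 hr]
      with y hy hyl hyr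
    rcases lt_trichotomy y x with hyx | rfl | hyx
    · exact ⟨hy, hyl hyx⟩
    · exact ⟨hy, hvx, hwx⟩
    · exact ⟨hy, hyr hyx⟩
  have hzero : ∀ {f : ℝ → ℝ} {l : Filter ℝ} {z : ℝ}, Tendsto f l (𝓝 z) →
      (∃ᶠ y in l, f y = 0) → z = 0 := fun {f l z} hf hfr => by
    by_contra hz
    exact hfr (hf.eventually_ne hz)
  have hUc : closure U ∩ I ⊆ U := by
    rintro x ⟨hxU, hx⟩
    obtain ⟨h1, h2⟩ := h.jump_eq hI hα hβ hx
    have hv' := hlim h.1 hx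
    have hw' := hlim h.2.1 hx
    have hωx := hω x hx
    unfold omegaFn at hωx
    have hfr : ∃ᶠ y in 𝓝 x, y ∈ U := mem_closure_iff_frequently.1 hxU
    rw [← nhdsNE_sup_pure, ← nhdsLT_sup_nhdsGT, frequently_sup, frequently_sup] at hfr
    rcases hfr with (hfr | hfr) | hfr
    · have e1 := hzero hv'.1 (hfr.mono fun _ h => h.2.1)
      have e2 := hzero hw'.1 (hfr.mono fun _ h => h.2.2)
      rw [h1] at e1
      rw [h2] at e2
      have hvx : v x = 0 := by
        refine (mul_eq_zero.1 ?_).resolve_right hωx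
        linear_combination e1 + jump α x / 2 * e2
      exact ⟨hx, hvx, by simpa [hvx] using e2⟩
    · have e1 := hzero hv'.2 (hfr.mono fun _ h => h.2.1)
      have e2 := hzero hw'.2 (hfr.mono fun _ h => h.2.2)
      rw [h1] at e1
      rw [h2] at e2
      have hvx : v x = 0 := by
        refine (mul_eq_zero.1 ?_).resolve_right hωx
        linear_combination e1 - jump α x / 2 * e2
      exact ⟨hx, hvx, by simpa [hvx] using e2⟩
    · simpa using hfr
  have := hIc.isPreconnected.subset_of_closure_inter_subset hUo ⟨s, hs, hs, hvs, hws⟩ hUc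
  exact fun x hx => (this hx).2.1

theorem changesSignAt_of_leftLim_mul_rightLim_neg {I : Set ℝ} (hI : IsOpen I) {f : ℝ → ℝ}
    (hf : LocallyBoundedVariationOn f I) {s : ℝ} (hs : s ∈ I)
    (h : leftLim f s * rightLim f s < 0) : ChangesSignAt I f s := by
  obtain ⟨hl, hr⟩ := hf.tendsto_leftLim_rightLim hI hs
  have hl' := (tendsto_leftLim_rightLim_nhdsWithin isOpen_Iio hl).1
  have hr' := (tendsto_leftLim_rightLim_nhdsWithin isOpen_Ioi hr).2
  have key : ∀ {P Q : ℝ → Prop}, (∀ᶠ x in 𝓝[<] s, P x) → (∀ᶠ x in 𝓝[>] s, Q x) →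
      ∃ δ > (0 : ℝ), Ioo (s - δ) (s + δ) ⊆ I ∧ (∀ x ∈ Ioo (s - δ) s, P x) ∧
        ∀ x ∈ Ioo s (s + δ), Q x := fun {P Q} hP hQ => by
    obtain ⟨δ, hδ, H⟩ := Metric.eventually_nhds_iff_ball.1 ((hI.eventually_mem hs).and
      ((eventually_nhdsWithin_iff.1 hP).and (eventually_nhdsWithin_iff.1 hQ)))
    rw [Real.ball_eq_Ioo] at H
    exact ⟨δ, hδ, fun x hx => (H x hx).1,
      fun x hx => (H x ⟨hx.1, by linarith [hx.2]⟩).2.1 hx.2,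
      fun x hx => (H x ⟨by linarith [hx.1], hx.2⟩).2.2 hx.1⟩
  rcases mul_neg_iff.1 h with ⟨h1, h2⟩ | ⟨h1, h2⟩
  · obtain ⟨δ, hδ, hδI, H⟩ := key (hl'.eventually_const_lt h1) (hr'.eventually_lt_const h2)
    exact ⟨δ, hδ, hδI, Or.inr H⟩
  · obtain ⟨δ, hδ, hδI, H⟩ := key (hl'.eventually_lt_const h1) (hr'.eventually_const_lt h2)
    exact ⟨δ, hδ, hδI, Or.inl H⟩

theorem jump_nonneg_of_monotoneOn {I : Set ℝ} (hI : IsOpen I) {f : ℝ → ℝ} (hf : MonotoneOn f I)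
    {s : ℝ} (hs : s ∈ I) : 0 ≤ jump f s := by
  obtain ⟨hl, hr⟩ := hf.locallyBoundedVariationOn.tendsto_leftLim_rightLim hI hs
  have h1 : leftLim f s ≤ f s := le_of_tendsto hl (by
    filter_upwards [nhdsWithin_le_nhds (hI.mem_nhds hs), self_mem_nhdsWithin] with x hx hxs
    exact hf hx hs (le_of_lt hxs))
  have h2 : f s ≤ rightLim f s := ge_of_tendsto hr (by
    filter_upwards [nhdsWithin_le_nhds (hI.mem_nhds hs), self_mem_nhdsWithin] with x hx hxs
    exact hf hs hx (le_of_lt hxs))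
  exact sub_nonneg.2 (h1.trans h2)

/-- The values at `s` are `u, p, v, q` (for `u, du/dα, v, dv/dα`) and `A` is the jump of `α`. -/
theorem wronskian_mul_pos {u p v q A : ℝ} (hv0 : v ≠ 0)
    (hu : (u - p * A / 2) * (u + p * A / 2) < 0) (hv : 0 ≤ (v - q * A / 2) * (v + q * A / 2)) :
    0 < v * p * (v * p - u * q) := by
  have hp : p ≠ 0 := by
    rintro rfl
    nlinarith [sq_nonneg u]
  have hA : A ≠ 0 := by
    rintro rfl
    nlinarith [sq_nonneg u]
  have hvp : 0 < (v * p) ^ 2 := by positivity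
  have hlt : (u * q) ^ 2 < (v * p) ^ 2 := by
    rcases eq_or_ne q 0 with rfl | hq
    · simpa using hvp
    · have hA2 : 0 < A ^ 2 := by positivity
      have hq2 : 0 < q ^ 2 := by positivity
      have hp2 : 0 < p ^ 2 := by positivity
      have h1 : u ^ 2 * q ^ 2 < (p * A / 2) ^ 2 * q ^ 2 := by
        apply mul_lt_mul_of_pos_right _ hq2
        linarith
      have h2 : (q * A / 2) ^ 2 * p ^ 2 ≤ v ^ 2 * p ^ 2 := by
        apply mul_le_mul_of_nonneg_right _ hp2.le
        linarith
      linarith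
  have habs : |u * q| < |v * p| := sq_lt_sq.1 hlt
  have h1 : v * p * (u * q) ≤ |v * p| * |u * q| := by
    rw [← abs_mul]
    exact le_abs_self _
  have h2 : |v * p| * |u * q| < |v * p| * |v * p| :=
    mul_lt_mul_of_pos_left habs ((abs_nonneg _).trans_lt habs)
  rw [abs_mul_abs_self] at h2
  linarith

theorem wronskian_one_sided_mul_pos {u p v q A B₁ B₂ : ℝ}
    (hW : 0 < v * p * (v * p - u * q)) (hA : 0 ≤ A)
    (hu : (u - p * A / 2) * (u + p * A / 2) < 0) (hω : 0 < 1 - A * B₁ / 4) (hB : B₂ ≤ B₁) :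
    0 < v * p * ((v - q * A / 2) * (p - u * B₁ / 2) - (u - p * A / 2) * (q - v * B₂ / 2)) ∧
    0 < v * p * ((v + q * A / 2) * (p + u * B₁ / 2) - (u + p * A / 2) * (q + v * B₂ / 2)) := by
  have hWω := mul_pos hω hW
  have habs : |p * u| ≤ p ^ 2 * A / 2 := by
    refine abs_le_of_sq_le_sq ?_ (by positivity)
    nlinarith [sq_nonneg p]
  obtain ⟨h1, h2⟩ := abs_le.1 habs
  have hc : 0 ≤ (B₁ - B₂) / 2 * v ^ 2 := mul_nonneg (by linarith) (sq_nonneg v)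
  constructor
  · have := mul_nonneg hc (sub_nonneg.2 h2)
    linear_combination hWω + this
  · have := mul_nonneg hc (neg_le_iff_add_nonneg.1 h1)
    linear_combination hWω + this

/-- Lemma 6.4: for nontrivial balanced solutions `u`, `v` of the two
equations, if `v` does not change sign at `s` and `u⁻(s) u⁺(s) < 0`, then
`v(s) (du/dα)(s) W̃[v,u](s) > 0`; if moreover `ω₁(s) > 0` and `Δ_{dβ₁}(s) ≥ Δ_{dβ₂}(s)`,
then also `v(s) (du/dα)(s) W̃∓[v,u](s) > 0`. -/
theorem statement18 (a b : EReal) (hab : a < b) (α β₁ β₂ : ℝ → ℝ)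
    (hα : StrictMonoOn α (EI a b))
    (hβ₁ : LocallyBoundedVariationOn β₁ (EI a b))
    (hβ₂ : LocallyBoundedVariationOn β₂ (EI a b))
    (hω : ∀ x ∈ EI a b, omegaFn α β₁ x ≠ 0 ∧ omegaFn α β₂ x ≠ 0)
    (u wu v wv : ℝ → ℝ)
    (hu : IsHomSol (EI a b) (1 / 2) α β₁ u wu)
    (hv : IsHomSol (EI a b) (1 / 2) α β₂ v wv)
    (hnu : ¬ ∀ x ∈ EI a b, u x = 0) (hnv : ¬ ∀ x ∈ EI a b, v x = 0)
    (s : ℝ) (hs : s ∈ EI a b)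
    (hnosign : ¬ ChangesSignAt (EI a b) v s)
    (hujump : leftLim u s * rightLim u s < 0) :
    0 < v s * wu s * (v s * wu s - u s * wv s) ∧
    ((0 < omegaFn α β₁ s ∧ jump β₂ s ≤ jump β₁ s) →
      0 < v s * wu s * leftLim (fun x => v x * wu x - u x * wv x) s ∧
      0 < v s * wu s * rightLim (fun x => v x * wu x - u x * wv x) s) := by
  have hI := isOpen_EI_s18 a b
  have hαbv := hα.monotoneOn.locallyBoundedVariationOn
  have hA := jump_nonneg_of_monotoneOn hI hα.monotoneOn hs
  obtain ⟨ju, jwu⟩ := hu.jump_eq hI hαbv hβ₁ hs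
  obtain ⟨jv, jwv⟩ := hv.jump_eq hI hαbv hβ₂ hs
  obtain ⟨ul, ur⟩ := hu.1.eq_leftLim_rightLim hs
  obtain ⟨wul, wur⟩ := hu.2.1.eq_leftLim_rightLim hs
  obtain ⟨vl, vr⟩ := hv.1.eq_leftLim_rightLim hs
  obtain ⟨wvl, wvr⟩ := hv.2.1.eq_leftLim_rightLim hs
  have hvjump : 0 ≤ leftLim v s * rightLim v s := not_lt.1 fun hneg =>
    hnosign (changesSignAt_of_leftLim_mul_rightLim_neg hI hv.1.1 hs hneg)
  obtain ⟨ulim, ulim'⟩ := hu.1.1.tendsto_leftLim_rightLim hI hs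
  obtain ⟨wulim, wulim'⟩ := hu.2.1.1.tendsto_leftLim_rightLim hI hs
  obtain ⟨vlim, vlim'⟩ := hv.1.1.tendsto_leftLim_rightLim hI hs
  obtain ⟨wvlim, wvlim'⟩ := hv.2.1.1.tendsto_leftLim_rightLim hI hs
  rw [leftLim_eq_of_tendsto ((vlim.mul wulim).sub (ulim.mul wvlim)),
    rightLim_eq_of_tendsto ((vlim'.mul wulim').sub (ulim'.mul wvlim'))]
  rw [ul, ur, ju] at hujump
  rw [vl, vr, jv] at hvjump
  rw [ul, ur, wul, wur, vl, vr, wvl, wvr, ju, jwu, jv, jwv]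
  have hv0 : v s ≠ 0 := by
    intro hv0
    have hA0 : jump α s ≠ 0 := by
      intro h0
      rw [h0] at hujump
      nlinarith [sq_nonneg (u s)]
    have hw0 : wv s = 0 := by
      rw [hv0] at hvjump
      have : (wv s * jump α s) ^ 2 = 0 := le_antisymm (by linarith) (sq_nonneg _)
      exact (mul_eq_zero.1 (pow_eq_zero_iff two_ne_zero |>.1 this)).resolve_right hA0
    exact hnv (hv.eq_zero_of_initial hI (ordConnected_EI_s18 a b) hαbv hβ₂
      (fun x hx => (hω x hx).2) hs hv0 hw0)
  have hW := wronskian_mul_pos hv0 hujump hvjump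
  exact ⟨hW, fun ⟨hω₁, hB⟩ => wronskian_one_sided_mul_pos hW hA hujump hω₁ hB⟩
end
end
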